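/- arXiv:2404.06445 — 2 statements merged into one kernel-verified Lean document; each statement's English description precedes it below -/
import Mathlib

section
/- Let G be a minimal bipartite matching covered graph with bipartition (A, B) satisfying |V2| = 2(m − n + 2), and let e be an edge of G both of whose endpoints have degree at least 3. Then there exist an edge f ≠ e, both of whose endpoints also have degree at least 3, and a set W of vertices with ∅ ⊊ W ⊊ V(G), such that the set of edges of G with exactly one endpoint in W is exactly {e, f}, and the endpoint of e lying in W and the endpoint of f lying in W belong to different classes of the bipartition (one is in A and the other is in B). -/
open SimpleGraph

/-- The degree of a vertex `v` in a graph `G`: the number of neighbours of `v`. -/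
noncomputable def degN {V : Type*} (G : SimpleGraph V) (v : V) : ℕ :=
  (G.neighborSet v).ncard

/-- A finite simple graph is matching covered if it is connected, has at least 4 vertices,
and every edge lies in some perfect matching. -/
def MatchingCovered {V : Type*} [Fintype V] (G : SimpleGraph V) : Prop :=
  G.Connected ∧ 4 ≤ Fintype.card V ∧
    ∀ e ∈ G.edgeSet, ∃ M : G.Subgraph, M.IsPerfectMatching ∧ e ∈ M.edgeSet

/-- A matching covered graph is minimal if deleting any edge destroys the property. -/
def MinimalMatchingCovered {V : Type*} [Fintype V] (G : SimpleGraph V) : Prop :=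
  MatchingCovered G ∧ ∀ e ∈ G.edgeSet, ¬ MatchingCovered (G.deleteEdges {e})

/-- The edge cut determined by a set `W` of vertices:
all edges of `G` with exactly one endpoint in `W`. -/
def edgeCut {V : Type*} (G : SimpleGraph V) (W : Set V) : Set (Sym2 V) :=
  {e | e ∈ G.edgeSet ∧ ∃ u v, e = s(u, v) ∧ u ∈ W ∧ v ∉ W}

namespace BipartiteEdges

open Finset

variable {V : Type*} [DecidableEq V]

/-- The left vertices of a bipartite graph given by its set of (left, right) edges. -/
def left (E : Finset (V × V)) : Finset V := E.image Prod.fst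

/-- The bipartite graph with the roles of left and right exchanged. -/
def flip (E : Finset (V × V)) : Finset (V × V) := E.image Prod.swap

/-- The right vertices adjacent to some left vertex in `X`. -/
def nbrs (E : Finset (V × V)) (X : Finset V) : Finset V := (E.filter (·.1 ∈ X)).image Prod.snd

/-- The degree of a left vertex. Right degrees are degrees in `flip E`. -/
def deg (E : Finset (V × V)) (s : V) : ℕ := (nbrs E {s}).card

/-- `X` certifies that the edge `(a, b)` cannot be removed without violating the strict
Hall condition. -/
structure Witness (E : Finset (V × V)) (a b : V) (X : Finset V) : Prop where
  sub : X ⊆ left E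
  ne : X ≠ left E
  mem : a ∈ X
  card : (nbrs E X).card ≤ X.card + 1
  uniq : ∀ x ∈ X, (x, b) ∈ E → x = a

/-- Minimal bipartite matching covered graphs, in terms of the strict Hall condition. -/
structure MinHall (E : Finset (V × V)) : Prop where
  balanced : (left E).card = (left (flip E)).card
  two_le : 2 ≤ (left E).card
  hall : ∀ X ⊆ left E, X.Nonempty → X ≠ left E → X.card < (nbrs E X).card
  witness : ∀ a b, (a, b) ∈ E → ∃ X, Witness E a b X

/-- The number of left vertices of degree two. -/
def numTwo (E : Finset (V × V)) : ℕ := ((left E).filter (deg E · = 2)).card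

/-- The excess of the number of degree two vertices over its minimum possible value. -/
def excess (E : Finset (V × V)) : ℤ :=
  numTwo E + numTwo (flip E) - 2 * E.card + 2 * ((left E).card + (left (flip E)).card) - 4

/-- An edge both of whose ends have degree at least three. -/
def Thick (E : Finset (V × V)) (a b : V) : Prop :=
  (a, b) ∈ E ∧ 3 ≤ deg E a ∧ 3 ≤ deg (flip E) b

/-- The edge `(a, b)` lies in a balanced 2-cut together with another thick edge. -/
def InCut (E : Finset (V × V)) (a b : V) : Prop :=
  ∃ c d, Thick E c d ∧ (c, d) ≠ (a, b) ∧ ∃ P Q : Set V,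
    (∀ s t, (s, t) ∈ E → (¬ (s ∈ P ↔ t ∈ Q) ↔ (s, t) = (a, b) ∨ (s, t) = (c, d))) ∧
    ((a ∈ P ∧ d ∈ Q) ∨ (b ∈ Q ∧ c ∈ P))

/-- A right vertex of degree two whose two neighbours both have degree two, or both have
larger degree. -/
def HasBicontraction (E : Finset (V × V)) : Prop :=
  ∃ a₁ a₂ t, (a₁, t) ∈ E ∧ (a₂, t) ∈ E ∧ a₁ ≠ a₂ ∧ deg (flip E) t = 2 ∧
    (deg E a₁ = 2 ↔ deg E a₂ = 2)

variable {E : Finset (V × V)} {X Y : Finset V} {a b s t : V}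

@[simp] lemma mem_left : s ∈ left E ↔ ∃ t, (s, t) ∈ E := by simp [left]

@[simp] lemma mem_flip : (t, s) ∈ flip E ↔ (s, t) ∈ E := by simp [flip]

@[simp] lemma flip_flip : flip (flip E) = E := by ext ⟨s, t⟩; simp

@[simp] lemma card_flip : (flip E).card = E.card :=
  card_image_of_injective _ Prod.swap_injective

@[simp] lemma mem_nbrs : t ∈ nbrs E X ↔ ∃ s ∈ X, (s, t) ∈ E := by
  simp [nbrs, and_comm]

lemma nbrs_mono (h : X ⊆ Y) : nbrs E X ⊆ nbrs E Y := by
  intro t; simp only [mem_nbrs]; rintro ⟨s, hs, h'⟩; exact ⟨s, h hs, h'⟩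

lemma nbrs_union : nbrs E (X ∪ Y) = nbrs E X ∪ nbrs E Y := by
  ext t; simp only [mem_nbrs, mem_union]; grind

lemma nbrs_inter_subset : nbrs E (X ∩ Y) ⊆ nbrs E X ∩ nbrs E Y := by
  intro t; simp only [mem_nbrs, mem_inter]; grind

lemma nbrs_subset : nbrs E X ⊆ left (flip E) := by
  intro t; simp only [mem_nbrs, mem_left, mem_flip]; grind

lemma excess_flip : excess (flip E) = excess E := by
  simp only [excess, flip_flip, card_flip]; ring

lemma thick_flip : Thick (flip E) b a ↔ Thick E a b := by
  simp only [Thick, flip_flip, mem_flip]; tauto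

lemma InCut.of_flip (h : InCut (flip E) b a) : InCut E a b := by
  obtain ⟨c, d, h1, h2, P, Q, h3, h4⟩ := h
  refine ⟨d, c, thick_flip.1 h1, by simp_all [and_comm], Q, P, ?_, by tauto⟩
  intro s t hst
  have := h3 t s (by simpa using hst)
  simp only [Prod.mk.injEq] at *
  tauto

lemma Witness.nonempty (h : Witness E a b X) : X.Nonempty := ⟨a, h.mem⟩

namespace MinHall

lemma card_nbrs_eq (h : MinHall E) (hw : Witness E a b X) : (nbrs E X).card = X.card + 1 := by
  have := h.hall X hw.sub hw.nonempty hw.ne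
  have := hw.card
  omega

lemma card_nbrs_left (h : MinHall E) : (nbrs E (left E)).card = (left E).card := by
  rw [h.balanced]; congr 1; ext t; simp only [mem_nbrs, mem_left, mem_flip]; grind

lemma hall_flip (h : MinHall E) (hX : X ⊆ left (flip E)) (hne : X.Nonempty)
    (hX' : X ≠ left (flip E)) : X.card < (nbrs (flip E) X).card := by
  set P := left E \ nbrs (flip E) X with hP
  have hsub : nbrs (flip E) X ⊆ left E := by simpa using nbrs_subset (E := flip E) (X := X)
  have hPc : P.card = (left E).card - (nbrs (flip E) X).card := card_sdiff_of_subset hsub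
  have h1 : nbrs E P ⊆ left (flip E) \ X := by
    intro t ht
    obtain ⟨s, hs, hst⟩ := mem_nbrs.1 ht
    rw [mem_sdiff]
    refine ⟨nbrs_subset ht, fun htX => ?_⟩
    rw [hP, mem_sdiff] at hs
    exact hs.2 (mem_nbrs.2 ⟨t, htX, by simpa using hst⟩)
  have h2 := card_le_card h1
  rw [card_sdiff_of_subset hX, ← h.balanced] at h2
  have h3 := card_le_card hX
  have h4 := card_le_card hsub
  rw [← h.balanced] at h3
  have hlt : X.card < (left E).card := by rw [h.balanced]; exact card_lt_card (hX.ssubset_of_ne hX')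
  rcases P.eq_empty_or_nonempty with hPe | hPn
  · rw [hPe, card_empty] at hPc; omega
  have hPL : P ≠ left E := by
    obtain ⟨t, ht⟩ := hne
    obtain ⟨s, hs⟩ := mem_left.1 (hX ht)
    intro hc
    have : s ∈ P := by rw [hc]; exact mem_left.2 ⟨t, by simpa using hs⟩
    rw [hP, mem_sdiff] at this
    exact this.2 (mem_nbrs.2 ⟨t, ht, hs⟩)
  have := h.hall P sdiff_subset hPn hPL
  omega

/-- The complement of the shore given by a witness, seen from the other side. -/
lemma witness_flip (h : MinHall E) (hab : (a, b) ∈ E) (hw : Witness E a b X) :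
    Witness (flip E) b a (left (flip E) \ (nbrs E X).erase b) ∧
      (left (flip E) \ (nbrs E X).erase b).card = (left E).card - X.card := by
  have hb : b ∈ nbrs E X := mem_nbrs.2 ⟨a, hw.mem, hab⟩
  have hbL : b ∈ left (flip E) := nbrs_subset hb
  have hc : ((nbrs E X).erase b).card = X.card := by
    rw [card_erase_of_mem hb, h.card_nbrs_eq hw]; rfl
  have hcard : (left (flip E) \ (nbrs E X).erase b).card = (left E).card - X.card := by
    rw [card_sdiff_of_subset ((erase_subset _ _).trans nbrs_subset), hc, h.balanced]
  refine ⟨⟨sdiff_subset, ?_, ?_, ?_, ?_⟩, hcard⟩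
  · intro hh
    rw [hh, ← h.balanced] at hcard
    have := card_pos.2 hw.nonempty
    have := card_le_card hw.sub
    omega
  · simp only [mem_sdiff, hbL, mem_erase]; tauto
  · rw [hcard]
    have : nbrs (flip E) (left (flip E) \ (nbrs E X).erase b) ⊆ insert a (left E \ X) := by
      intro s hs
      obtain ⟨t, ht, hts⟩ := mem_nbrs.1 hs
      rw [mem_flip] at hts
      rw [mem_insert, mem_sdiff]
      by_cases hsX : s ∈ X
      · left
        rw [mem_sdiff, mem_erase] at ht
        have : t = b := by
          by_contra hne
          exact ht.2 ⟨hne, mem_nbrs.2 ⟨s, hsX, hts⟩⟩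
        exact hw.uniq s hsX (this ▸ hts)
      · exact Or.inr ⟨mem_left.2 ⟨t, hts⟩, hsX⟩
    refine (card_le_card this).trans ((card_insert_le _ _).trans ?_)
    rw [card_sdiff_of_subset hw.sub]
  · intro x hx hxa
    rw [mem_flip] at hxa
    rw [mem_sdiff, mem_erase] at hx
    by_contra hne
    exact hx.2 ⟨hne, mem_nbrs.2 ⟨a, hw.mem, hxa⟩⟩

lemma flip (h : MinHall E) : MinHall (flip E) where
  balanced := by rw [flip_flip, h.balanced]
  two_le := h.balanced ▸ h.two_le
  hall _ hX hne hX' := h.hall_flip hX hne hX'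
  witness b a hba := by
    rw [mem_flip] at hba
    obtain ⟨X, hw⟩ := h.witness a b hba
    exact ⟨_, (h.witness_flip hba hw).1⟩

lemma two_le_deg (h : MinHall E) (hs : s ∈ left E) : 2 ≤ deg E s := by
  have := h.hall {s} (by simpa using hs) (by simp) (by
    intro hc; have := h.two_le; rw [← hc] at this; simp at this)
  rwa [card_singleton] at this

/-- Uncrossing of two tight sets. -/
lemma uncross (h : MinHall E) (hX : X ⊆ left E) (hY : Y ⊆ left E)
    (cX : (nbrs E X).card ≤ X.card + 1) (cY : (nbrs E Y).card ≤ Y.card + 1)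
    (hi : (X ∩ Y).Nonempty) (hu : X ∪ Y ≠ left E) :
    (nbrs E (X ∪ Y)).card ≤ (X ∪ Y).card + 1 ∧ (nbrs E (X ∩ Y)).card ≤ (X ∩ Y).card + 1 ∧
      nbrs E (X ∩ Y) = nbrs E X ∩ nbrs E Y := by
  have h1 := h.hall (X ∪ Y) (union_subset hX hY)
    (hi.mono (inter_subset_left.trans subset_union_left)) hu
  have h2 := h.hall (X ∩ Y) (inter_subset_left.trans hX) hi (by
    intro hc
    exact hu ((union_subset hX hY).antisymm
      (hc ▸ inter_subset_left.trans subset_union_left)))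
  have h3 := card_le_card (nbrs_inter_subset (E := E) (X := X) (Y := Y))
  have h4 := card_union_add_card_inter (nbrs E X) (nbrs E Y)
  rw [← nbrs_union] at h4
  have h5 := card_union_add_card_inter X Y
  refine ⟨by omega, by omega, eq_of_subset_of_card_le nbrs_inter_subset (by omega)⟩

end MinHall

lemma mem_nbrs_singleton : t ∈ nbrs E {s} ↔ (s, t) ∈ E := by simp

lemma deg_eq_card_filter : deg E s = (E.filter (·.1 = s)).card := by
  rw [deg, nbrs, card_image_of_injOn]
  · simp
  · rintro ⟨x, y⟩ hx ⟨x', y'⟩ hx' h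
    simp at hx hx' h
    simp [hx.2, hx'.2, h]

lemma deg_flip_eq_card_filter : deg (flip E) t = (E.filter (·.2 = t)).card := by
  rw [deg_eq_card_filter, flip, filter_image, card_image_of_injective _ Prod.swap_injective]
  rfl

lemma eq_or_eq_of_deg_eq_two {t₁ t₂ : V} (hd : deg E s = 2) (h1 : (s, t₁) ∈ E) (h2 : (s, t₂) ∈ E)
    (hne : t₁ ≠ t₂) (h : (s, t) ∈ E) : t = t₁ ∨ t = t₂ := by
  have hsub : ({t₁, t₂} : Finset V) ⊆ nbrs E {s} := by
    intro x hx
    rw [mem_nbrs_singleton]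
    rcases mem_insert.1 hx with rfl | hx
    · exact h1
    · rw [mem_singleton.1 hx]; exact h2
  have := eq_of_subset_of_card_le hsub (by rw [card_pair hne]; exact hd.le)
  have h3 := mem_nbrs_singleton.2 h
  rw [← this] at h3
  simpa using h3

lemma exists_ne_of_two_le_deg (hd : 2 ≤ deg E s) (t : V) : ∃ t', (s, t') ∈ E ∧ t' ≠ t := by
  obtain ⟨t', ht', hne⟩ := exists_mem_ne (show 1 < (nbrs E {s}).card from hd) t
  exact ⟨t', mem_nbrs_singleton.1 ht', hne⟩

section Bicontraction

variable {a₁ a₂ : V}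

/-- Contraction of the star at the degree two right vertex `t` with neighbours `a₁` and `a₂`. -/
def bicontract (E : Finset (V × V)) (a₁ a₂ t : V) : Finset (V × V) :=
  (E.filter (·.2 ≠ t)).image (Prod.map (fun s => if s = a₂ then a₁ else s) id)

lemma mem_bicontract (hne : a₁ ≠ a₂) {c : V} : (s, c) ∈ bicontract E a₁ a₂ t ↔
    c ≠ t ∧ s ≠ a₂ ∧ ((s, c) ∈ E ∨ (s = a₁ ∧ (a₂, c) ∈ E)) := by
  simp only [bicontract, mem_image, mem_filter, Prod.exists, Prod.map_apply, id, Prod.mk.injEq]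
  constructor
  · rintro ⟨x, y, ⟨h1, h2⟩, h3, rfl⟩
    split_ifs at h3 with h4
    · subst h4 h3; exact ⟨h2, hne, Or.inr ⟨rfl, h1⟩⟩
    · subst h3; exact ⟨h2, h4, Or.inl h1⟩
  · rintro ⟨h1, h2, h3 | ⟨rfl, h3⟩⟩
    · exact ⟨s, c, ⟨h3, h1⟩, by simp [h2]⟩
    · exact ⟨a₂, c, ⟨h3, h1⟩, by simp⟩

variable (h : MinHall E) (h1 : (a₁, t) ∈ E) (h2 : (a₂, t) ∈ E) (hne : a₁ ≠ a₂)
  (ht : deg (flip E) t = 2)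

include h1 h2 hne ht in
lemma eq_or_eq_of_mem (hs : (s, t) ∈ E) : s = a₁ ∨ s = a₂ :=
  eq_or_eq_of_deg_eq_two ht (mem_flip.2 h1) (mem_flip.2 h2) hne (mem_flip.2 hs)

include h1 h2 hne ht in
/-- A tight set containing exactly one neighbour of `t` can be shrunk. -/
lemma card_nbrs_erase_le (hX : (nbrs E X).card ≤ X.card + 1) (ha : a₁ ∈ X) (ha' : a₂ ∉ X) :
    (nbrs E (X.erase a₁)).card ≤ (X.erase a₁).card + 1 ∧ nbrs E (X.erase a₁) ⊆ (nbrs E X).erase t := by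
  have hsub : nbrs E (X.erase a₁) ⊆ (nbrs E X).erase t := by
    intro c hc
    rw [mem_erase]
    refine ⟨?_, nbrs_mono (erase_subset _ _) hc⟩
    rintro rfl
    obtain ⟨s, hs, hsc⟩ := mem_nbrs.1 hc
    rw [mem_erase] at hs
    rcases eq_or_eq_of_mem h1 h2 hne ht hsc with rfl | rfl
    · exact hs.1 rfl
    · exact ha' hs.2
  refine ⟨?_, hsub⟩
  have h3 := card_le_card hsub
  rw [card_erase_of_mem (mem_nbrs.2 ⟨a₁, ha, h1⟩)] at h3
  rw [card_erase_of_mem ha]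
  have := card_pos.2 ⟨_, ha⟩
  omega

include h h1 h2 hne ht in
/-- If a tight set certifying an edge at `a₁` misses `a₂`, then it is `{a₁}`. -/
lemma witness_eq_singleton {c : V} (hc : (a₁, c) ∈ E) (hct : c ≠ t) (hw : Witness E a₁ c X)
    (ha' : a₂ ∉ X) : X = {a₁} := by
  by_contra hX
  obtain ⟨-, h4⟩ := card_nbrs_erase_le h1 h2 hne ht hw.card hw.mem ha'
  have h5 : nbrs E (X.erase a₁) ⊆ ((nbrs E X).erase t).erase c := by
    refine subset_erase.2 ⟨h4, fun hcc => ?_⟩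
    obtain ⟨s, hs, hsc⟩ := mem_nbrs.1 hcc
    rw [mem_erase] at hs
    exact hs.1 (hw.uniq s hs.2 hsc)
  have h6 := card_le_card h5
  rw [card_erase_of_mem (mem_erase.2 ⟨hct, mem_nbrs.2 ⟨a₁, hw.mem, hc⟩⟩),
    card_erase_of_mem (mem_nbrs.2 ⟨a₁, hw.mem, h1⟩)] at h6
  have h7 : (X.erase a₁).Nonempty := by
    rw [nonempty_iff_ne_empty]
    intro he
    rcases erase_eq_empty_iff _ _ |>.1 he with he | he
    · exact (he ▸ hw.nonempty).ne_empty rfl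
    · exact hX he
  have h8 := h.hall _ ((erase_subset _ _).trans hw.sub) h7 (by
    intro hc
    have : a₁ ∈ X.erase a₁ := by rw [hc]; exact hw.sub hw.mem
    simp at this)
  have := card_erase_of_mem hw.mem
  have := hw.card
  have := card_pos.2 h7
  omega

include h h1 h2 hne ht in
lemma no_common_neighbor (hiff : deg E a₁ = 2 ↔ deg E a₂ = 2) (hL : 3 ≤ (left E).card) {c : V}
    (hct : c ≠ t) (hc1 : (a₁, c) ∈ E) (hc2 : (a₂, c) ∈ E) : False := by
  obtain ⟨X, hw⟩ := h.witness _ _ hc1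
  have ha : a₂ ∉ X := fun ha => hne (hw.uniq _ ha hc2).symm
  have hX := witness_eq_singleton h h1 h2 hne ht hc1 hct hw ha
  have hd1 : deg E a₁ = 2 := by
    have := h.card_nbrs_eq hw
    rw [hX] at this
    simpa [deg] using this
  have hd2 := hiff.1 hd1
  have hsub : nbrs E {a₁, a₂} ⊆ {t, c} := by
    intro y hy
    simp only [mem_nbrs, mem_insert, mem_singleton, exists_eq_or_imp, exists_eq_left] at hy ⊢
    rcases hy with hy | hy
    · exact eq_or_eq_of_deg_eq_two hd1 h1 hc1 hct.symm hy
    · exact eq_or_eq_of_deg_eq_two hd2 h2 hc2 hct.symm hy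
  have hlt := h.hall {a₁, a₂} (by
    intro x hx
    rcases mem_insert.1 hx with rfl | hx
    · exact mem_left.2 ⟨_, h1⟩
    · rw [mem_singleton.1 hx]; exact mem_left.2 ⟨_, h2⟩) (by simp) (by
      intro hc; rw [← hc, card_pair hne] at hL; omega)
  have := card_le_card hsub
  rw [card_pair hne] at hlt
  rw [card_pair hct.symm] at this
  omega

include h h1 hne in
lemma left_bicontract : left (bicontract E a₁ a₂ t) = (left E).erase a₂ := by
  ext s
  simp only [mem_left, mem_bicontract hne, mem_erase]
  constructor
  · rintro ⟨c, hc, hs, h3 | ⟨rfl, -⟩⟩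
    · exact ⟨hs, c, h3⟩
    · exact ⟨hs, t, h1⟩
  · rintro ⟨hs, c, hc⟩
    obtain ⟨c', h3, h4⟩ := exists_ne_of_two_le_deg (h.two_le_deg (mem_left.2 ⟨c, hc⟩)) t
    exact ⟨c', h4, hs, Or.inl h3⟩

include h1 hne in
lemma left_flip_bicontract :
    left (flip (bicontract E a₁ a₂ t)) = (left (flip E)).erase t := by
  ext c
  simp only [mem_left, mem_flip, mem_bicontract hne, mem_erase]
  constructor
  · rintro ⟨s, hc, hs, h3 | ⟨rfl, h3⟩⟩
    · exact ⟨hc, s, h3⟩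
    · exact ⟨hc, a₂, h3⟩
  · rintro ⟨hc, s, hs⟩
    by_cases hsa : s = a₂
    · subst hsa
      exact ⟨a₁, hc, hne, Or.inr ⟨rfl, hs⟩⟩
    · exact ⟨s, hc, hsa, Or.inl hs⟩

include h1 h2 hne ht in
lemma nbrs_bicontract_of_notMem (ha : a₁ ∉ X) (ha' : a₂ ∉ X) :
    nbrs (bicontract E a₁ a₂ t) X = nbrs E X := by
  ext c
  simp only [mem_nbrs, mem_bicontract hne]
  constructor
  · rintro ⟨s, hs, -, -, h3 | ⟨rfl, -⟩⟩
    · exact ⟨s, hs, h3⟩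
    · exact absurd hs ha
  · rintro ⟨s, hs, hsc⟩
    refine ⟨s, hs, ?_, fun hh => ha' (hh ▸ hs), Or.inl hsc⟩
    rintro rfl
    rcases eq_or_eq_of_mem h1 h2 hne ht hsc with rfl | rfl <;> contradiction

include h1 h2 hne in
lemma nbrs_bicontract_of_mem (ha : a₁ ∈ X) (ha' : a₂ ∈ X) :
    nbrs (bicontract E a₁ a₂ t) (X.erase a₂) = (nbrs E X).erase t := by
  ext c
  simp only [mem_nbrs, mem_bicontract hne, mem_erase]
  constructor
  · rintro ⟨s, hs, hct, -, h3 | ⟨rfl, h3⟩⟩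
    · exact ⟨hct, s, hs.2, h3⟩
    · exact ⟨hct, _, ha', h3⟩
  · rintro ⟨hct, s, hs, hsc⟩
    by_cases hsa : s = a₂
    · subst hsa
      exact ⟨a₁, ⟨hne, ha⟩, hct, hne, Or.inr ⟨rfl, hsc⟩⟩
    · exact ⟨s, ⟨hsa, hs⟩, hct, hsa, Or.inl hsc⟩

lemma HasBicontraction.exists_smaller (h : MinHall E) (hL : 3 ≤ (left E).card)
    (hb : HasBicontraction E) :
    ∃ E' : Finset (V × V), MinHall E' ∧ (left E').card < (left E).card ∧ excess E' < excess E := by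
  obtain ⟨a₁, a₂, t, h1, h2, hne, ht, hiff⟩ := hb
  have hnc := fun c => no_common_neighbor h h1 h2 hne ht hiff hL (c := c)
  have ha1 : a₁ ∈ left E := mem_left.2 ⟨_, h1⟩
  have ha2 : a₂ ∈ left E := mem_left.2 ⟨_, h2⟩
  have htR : t ∈ left (flip E) := mem_left.2 ⟨a₁, mem_flip.2 h1⟩
  have hLE := left_bicontract h h1 hne
  have hRE := left_flip_bicontract (t := t) h1 hne
  have hLc : (left (bicontract E a₁ a₂ t)).card + 1 = (left E).card := by
    rw [hLE]; exact card_erase_add_one ha2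
  have hRc : (left (flip (bicontract E a₁ a₂ t))).card + 1 = (left (flip E)).card := by
    rw [hRE]; exact card_erase_add_one htR
  have hdeg1 : deg (bicontract E a₁ a₂ t) a₁ + 2 = deg E a₁ + deg E a₂ := by
    have h3 := nbrs_bicontract_of_mem (X := {a₁, a₂}) h1 h2 hne (by simp) (by simp)
    have h4 : ({a₁, a₂} : Finset V).erase a₂ = {a₁} := by ext; simp; grind
    have h5 : nbrs E {a₁, a₂} = nbrs E {a₁} ∪ nbrs E {a₂} := by rw [← nbrs_union]; rfl
    have h6 : nbrs E {a₁} ∩ nbrs E {a₂} = {t} := by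
      ext c
      simp only [mem_inter, mem_nbrs_singleton, mem_singleton]
      constructor
      · rintro ⟨h7, h8⟩
        by_contra hc
        exact hnc c hc h7 h8
      · rintro rfl; exact ⟨h1, h2⟩
    have h7 := card_union_add_card_inter (nbrs E {a₁}) (nbrs E {a₂})
    rw [← h5, h6, card_singleton] at h7
    have h8 := card_erase_add_one (s := nbrs E {a₁, a₂}) (a := t) (mem_nbrs.2 ⟨a₁, by simp, h1⟩)
    rw [← h3, h4] at h8
    unfold deg
    omega
  have hdeg : ∀ s, s ≠ a₁ → s ≠ a₂ → deg (bicontract E a₁ a₂ t) s = deg E s := by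
    intro s hs1 hs2
    rw [deg, nbrs_bicontract_of_notMem h1 h2 hne ht (by simpa using hs1.symm)
      (by simpa using hs2.symm), deg]
  have hdegf : ∀ c, c ≠ t → deg (flip (bicontract E a₁ a₂ t)) c = deg (flip E) c := by
    intro c hct
    have : nbrs (flip (bicontract E a₁ a₂ t)) {c} =
        (nbrs (flip E) {c}).image (fun s => if s = a₂ then a₁ else s) := by
      ext s
      simp only [mem_nbrs_singleton, mem_flip, mem_bicontract hne, mem_image]
      constructor
      · rintro ⟨-, hs, h3 | ⟨rfl, h3⟩⟩
        · exact ⟨s, h3, by simp [hs]⟩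
        · exact ⟨a₂, h3, by simp⟩
      · rintro ⟨s', h3, h4⟩
        split_ifs at h4 with h5
        · subst h4 h5; exact ⟨hct, hne, Or.inr ⟨rfl, h3⟩⟩
        · subst h4; exact ⟨hct, h5, Or.inl h3⟩
    rw [deg, this, card_image_of_injOn, deg]
    intro x hx y hy hxy
    simp only [mem_coe, mem_nbrs_singleton, mem_flip] at hx hy
    have := hnc c hct
    grind
  have hm : (bicontract E a₁ a₂ t).card + 2 = E.card := by
    have h3 : (bicontract E a₁ a₂ t).card = (E.filter (·.2 ≠ t)).card := by
      refine card_image_of_injOn ?_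
      rintro ⟨x, c⟩ hx ⟨y, d⟩ hy hxy
      simp only [mem_coe, mem_filter, Prod.map_apply, id, Prod.mk.injEq] at hx hy hxy
      have := hnc c hx.2
      grind
    rw [h3, ← ht, deg_flip_eq_card_filter, add_comm]
    exact card_filter_add_card_filter_not _
  refine ⟨bicontract E a₁ a₂ t, ⟨by have := h.balanced; omega, by omega, ?_, ?_⟩, by omega, ?_⟩
  · intro P hP hPn hPL
    rw [hLE] at hP
    have ha2P : a₂ ∉ P := fun hh => by simpa using hP hh
    by_cases ha1P : a₁ ∈ P
    · have h3 := nbrs_bicontract_of_mem (X := insert a₂ P) h1 h2 hne (by simp [ha1P]) (by simp)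
      rw [erase_insert ha2P] at h3
      have h4 := h.hall (insert a₂ P) (insert_subset ha2 (hP.trans (erase_subset _ _)))
        (by simp) (by
          intro hc; apply hPL; rw [hLE, ← hc, erase_insert ha2P])
      rw [h3, card_erase_of_mem (mem_nbrs.2 ⟨a₂, by simp, h2⟩)]
      rw [card_insert_of_notMem ha2P] at h4
      omega
    · rw [nbrs_bicontract_of_notMem h1 h2 hne ht ha1P ha2P]
      exact h.hall P (hP.trans (erase_subset _ _)) hPn (fun hc => ha2P (hc ▸ ha2))
  · have outer : ∀ s c X, s ≠ a₁ → s ≠ a₂ → Witness E s c X → a₁ ∉ X → a₂ ∉ X →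
        Witness (bicontract E a₁ a₂ t) s c X := by
      intro s c X hs1 hs2 hw hX1 hX2
      refine ⟨?_, ?_, hw.mem, ?_, ?_⟩
      · rw [hLE]; exact subset_erase.2 ⟨hw.sub, hX2⟩
      · rw [hLE]; intro hc; apply hX1; rw [hc]; exact mem_erase.2 ⟨hne, ha1⟩
      · rw [nbrs_bicontract_of_notMem h1 h2 hne ht hX1 hX2]; exact hw.card
      · intro x hx hxc
        rw [mem_bicontract hne] at hxc
        rcases hxc.2.2 with h3 | ⟨rfl, -⟩
        · exact hw.uniq x hx h3
        · exact absurd hx hX1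
    have inner : ∀ X, X ⊆ left E → X ≠ left E → (nbrs E X).card ≤ X.card + 1 → a₁ ∈ X → a₂ ∈ X →
        X.erase a₂ ⊆ left (bicontract E a₁ a₂ t) ∧ X.erase a₂ ≠ left (bicontract E a₁ a₂ t) ∧
        (nbrs (bicontract E a₁ a₂ t) (X.erase a₂)).card ≤ (X.erase a₂).card + 1 := by
      intro X h3 h4 h5 hX1 hX2
      refine ⟨?_, ?_, ?_⟩
      · rw [hLE]; exact erase_subset_erase _ h3
      · rw [hLE]; intro hc; apply h4; rw [← insert_erase hX2, hc, insert_erase ha2]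
      · rw [nbrs_bicontract_of_mem h1 h2 hne hX1 hX2,
          card_erase_of_mem (mem_nbrs.2 ⟨a₁, hX1, h1⟩), card_erase_of_mem hX2]
        omega
    -- an edge whose left end is one of the two merged vertices
    have merged : ∀ a' a'' c, (a' = a₁ ∧ a'' = a₂ ∨ a' = a₂ ∧ a'' = a₁) → (a', c) ∈ E → c ≠ t →
        ∃ X, Witness (bicontract E a₁ a₂ t) a₁ c X := by
      intro a' a'' c hor hc hct
      obtain ⟨h1', h2', hne', hiff'⟩ : (a', t) ∈ E ∧ (a'', t) ∈ E ∧ a' ≠ a'' ∧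
          (deg E a' = 2 ↔ deg E a'' = 2) := by
        rcases hor with ⟨rfl, rfl⟩ | ⟨rfl, rfl⟩
        · exact ⟨h1, h2, hne, hiff⟩
        · exact ⟨h2, h1, hne.symm, hiff.symm⟩
      obtain ⟨X, hw⟩ := h.witness _ _ hc
      by_cases haX : a'' ∈ X
      · have hX1 : a₁ ∈ X := by rcases hor with ⟨rfl, rfl⟩ | ⟨rfl, rfl⟩ <;> [exact hw.mem; exact haX]
        have hX2 : a₂ ∈ X := by rcases hor with ⟨rfl, rfl⟩ | ⟨rfl, rfl⟩ <;> [exact haX; exact hw.mem]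
        obtain ⟨h3, h4, h5⟩ := inner X hw.sub hw.ne hw.card hX1 hX2
        refine ⟨X.erase a₂, h3, h4, mem_erase.2 ⟨hne, hX1⟩, h5, ?_⟩
        intro x hx hxc
        rw [mem_bicontract hne] at hxc
        rw [mem_erase] at hx
        rcases hxc.2.2 with h6 | ⟨h6, -⟩
        · have := hw.uniq x hx.2 h6
          rcases hor with ⟨rfl, rfl⟩ | ⟨rfl, rfl⟩
          · exact this
          · exact absurd this hx.1
        · exact h6
      · have hX := witness_eq_singleton h h1' h2' hne' ht hc hct hw haX
        have hd1 : deg E a' = 2 := by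
          have := h.card_nbrs_eq hw
          rw [hX] at this
          simpa [deg] using this
        have hd2 := hiff'.1 hd1
        have hd3 : deg (bicontract E a₁ a₂ t) a₁ = 2 := by
          rcases hor with ⟨rfl, rfl⟩ | ⟨rfl, rfl⟩ <;> omega
        refine ⟨{a₁}, ?_, ?_, by simp, by rw [card_singleton]; exact hd3.le, by simp⟩
        · rw [hLE, singleton_subset_iff]; exact mem_erase.2 ⟨hne, ha1⟩
        · intro hc
          rw [← hc, card_singleton] at hLc
          omega
    intro s c hsc
    rw [mem_bicontract hne] at hsc
    obtain ⟨hct, hs2, hor⟩ := hsc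
    by_cases hs1 : s = a₁
    · subst hs1
      rcases hor with hor | ⟨-, hor⟩
      · exact merged s a₂ c (Or.inl ⟨rfl, rfl⟩) hor hct
      · exact merged a₂ s c (Or.inr ⟨rfl, rfl⟩) hor hct
    · have hor : (s, c) ∈ E := by tauto
      obtain ⟨X, hw⟩ := h.witness _ _ hor
      have shrink : ∀ x, x ≠ s → x ∈ left E → (nbrs E (X.erase x)).card ≤ (X.erase x).card + 1 →
          Witness E s c (X.erase x) := fun x hx hxL hX =>
        ⟨(erase_subset _ _).trans hw.sub, fun hc => by rw [← hc] at hxL; simp at hxL,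
          mem_erase.2 ⟨hx.symm, hw.mem⟩, hX, fun y hy => hw.uniq y (mem_of_mem_erase hy)⟩
      by_cases hX1 : a₁ ∈ X <;> by_cases hX2 : a₂ ∈ X
      · obtain ⟨h3, h4, h5⟩ := inner X hw.sub hw.ne hw.card hX1 hX2
        refine ⟨X.erase a₂, h3, h4, mem_erase.2 ⟨hs2, hw.mem⟩, h5, ?_⟩
        intro x hx hxc
        rw [mem_bicontract hne] at hxc
        rcases hxc.2.2 with h6 | ⟨rfl, h6⟩
        · exact hw.uniq x (mem_of_mem_erase hx) h6
        · exact absurd (hw.uniq _ hX2 h6).symm hs2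
      · have h3 := (card_nbrs_erase_le h1 h2 hne ht hw.card hX1 hX2).1
        exact ⟨_, outer s c _ hs1 hs2 (shrink a₁ (Ne.symm hs1) ha1 h3) (by simp) (by simp [hX2])⟩
      · have h3 := (card_nbrs_erase_le h2 h1 hne.symm ht hw.card hX2 hX1).1
        exact ⟨_, outer s c _ hs1 hs2 (shrink a₂ (Ne.symm hs2) ha2 h3) (by simp [hX1]) (by simp)⟩
      · exact ⟨X, outer s c X hs1 hs2 hw hX1 hX2⟩
  · have hn1 : numTwo (bicontract E a₁ a₂ t) ≤ numTwo E := by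
      refine card_le_card fun s hs => ?_
      rw [hLE, mem_filter, mem_erase] at hs
      rw [mem_filter]
      refine ⟨hs.1.2, ?_⟩
      by_cases hs1 : s = a₁
      · subst hs1
        have := h.two_le_deg ha1
        have := h.two_le_deg ha2
        omega
      · rw [← hdeg s hs1 hs.1.1]; exact hs.2
    have hn2 : numTwo (flip (bicontract E a₁ a₂ t)) + 1 ≤ numTwo (flip E) := by
      rw [numTwo, numTwo, hRE,
        ← card_erase_add_one (s := (left (flip E)).filter (deg (flip E) · = 2)) (a := t)
          (mem_filter.2 ⟨htR, ht⟩)]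
      gcongr
      intro c hc
      rw [mem_filter, mem_erase] at hc
      rw [mem_erase, mem_filter]
      exact ⟨hc.1.1, hc.1.2, by rw [← hdegf c hc.1.1]; exact hc.2⟩
    unfold excess
    omega

end Bicontraction

/-- `X` and `Y` form a balanced set left by the edge `(a, b)` only, in the direction from left
to right. -/
structure IsShore (E : Finset (V × V)) (a b : V) (X Y : Finset V) : Prop where
  sub : X ⊆ left E
  ne : X ≠ left E
  mem : a ∈ X
  notMem : b ∉ Y
  edge : (a, b) ∈ E
  card_eq : Y.card = X.card
  out : ∀ x ∈ X, ∀ y, (x, y) ∈ E → y ∈ Y ∨ (x = a ∧ y = b)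
  cover : ∀ y ∈ Y, ∃ x ∈ X, (x, y) ∈ E

lemma MinHall.isShore (h : MinHall E) (hab : (a, b) ∈ E) (hw : Witness E a b X) :
    IsShore E a b X ((nbrs E X).erase b) where
  sub := hw.sub
  ne := hw.ne
  mem := hw.mem
  notMem := by simp
  edge := hab
  card_eq := by
    rw [card_erase_of_mem (mem_nbrs.2 ⟨a, hw.mem, hab⟩), h.card_nbrs_eq hw]; rfl
  out x hx y hxy := by
    by_cases hyb : y = b
    · subst hyb; exact Or.inr ⟨hw.uniq x hx hxy, rfl⟩
    · exact Or.inl (mem_erase.2 ⟨hyb, mem_nbrs.2 ⟨x, hx, hxy⟩⟩)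
  cover y hy := mem_nbrs.1 (mem_of_mem_erase hy)

/-- Replace the shore `X ∪ Y` by the single edge `(a, c)`. -/
def contractShore (E : Finset (V × V)) (X Y : Finset V) (a c : V) : Finset (V × V) :=
  E.image (Prod.map (fun s => if s ∈ X then a else s) (fun t => if t ∈ Y then c else t))

/-- The left vertices outside `X` with a neighbour in `Y`. -/
def inNbrs (E : Finset (V × V)) (X Y : Finset V) : Finset V :=
  (left E \ X).filter (fun s => ∃ y ∈ Y, (s, y) ∈ E)

lemma mem_inNbrs : s ∈ inNbrs E X Y ↔ s ∉ X ∧ ∃ y ∈ Y, (s, y) ∈ E := by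
  simp only [inNbrs, mem_filter, mem_sdiff, mem_left]; grind

namespace IsShore

variable {c : V} (hS : IsShore E a b X Y)

include hS

lemma nbrs_eq : nbrs E X = insert b Y := by
  ext y
  rw [mem_nbrs, mem_insert]
  constructor
  · rintro ⟨x, hx, hxy⟩
    have := hS.out x hx y hxy
    tauto
  · rintro (rfl | hy)
    · exact ⟨a, hS.mem, hS.edge⟩
    · exact hS.cover y hy

lemma card_nbrs : (nbrs E X).card = X.card + 1 := by
  rw [hS.nbrs_eq, card_insert_of_notMem hS.notMem, hS.card_eq]

lemma witness : Witness E a b X where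
  sub := hS.sub
  ne := hS.ne
  mem := hS.mem
  card := hS.card_nbrs.le
  uniq x hx hxb := by
    rcases hS.out x hx b hxb with h | h
    · exact absurd h hS.notMem
    · exact h.1

lemma exists_outer_nbr (h : MinHall E) : ∃ s, s ∉ X ∧ (s, b) ∈ E := by
  obtain ⟨s, hs, hne⟩ := exists_ne_of_two_le_deg
    (h.flip.two_le_deg (mem_left.2 ⟨a, mem_flip.2 hS.edge⟩)) a
  rw [mem_flip] at hs
  refine ⟨s, fun hsX => ?_, hs⟩
  have := hS.out s hsX b hs
  have := hS.notMem
  tauto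

lemma right_sub : Y ⊆ left (flip E) := fun y hy => by
  obtain ⟨x, -, hxy⟩ := hS.cover y hy
  exact mem_left.2 ⟨x, mem_flip.2 hxy⟩

/-- A thick edge inside a minimum shore is the only edge from the shore to its right end. -/
lemma uniq_of_thick (h : MinHall E)
    (hmin₁ : ∀ a' b' X', Thick E a' b' → Witness E a' b' X' → X.card ≤ X'.card)
    (hmin₂ : ∀ a' b' X', Thick E a' b' → Witness E a' b' X' → X.card ≤ (left E).card - X'.card)
    {x y : V} (hxy : Thick E x y) (hx : x ∈ X) : ∀ x' ∈ X, (x', y) ∈ E → x' = x := by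
  obtain ⟨X', hw⟩ := h.witness x y hxy.1
  have hi : x ∈ X ∩ X' := mem_inter.2 ⟨hx, hw.mem⟩
  by_cases hu : X ∪ X' = left E
  · exfalso
    have h1 := hmin₂ x y X' hxy hw
    have h2 := card_union_add_card_inter X X'
    rw [hu] at h2
    have h3 := card_pos.2 ⟨_, hi⟩
    have h4 := card_pos.2 ⟨_, hx⟩
    omega
  · obtain ⟨-, h2, -⟩ := h.uncross hS.sub hw.sub hS.card_nbrs.le hw.card ⟨_, hi⟩ hu
    have hw' : Witness E x y (X ∩ X') := by
      refine ⟨inter_subset_left.trans hS.sub, ?_, hi, h2, ?_⟩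
      · intro hc
        exact hS.ne (hS.sub.antisymm (hc ▸ inter_subset_left))
      · intro z hz; exact hw.uniq z (mem_of_mem_inter_right hz)
    have h3 := eq_of_subset_of_card_le inter_subset_left (hmin₁ x y _ hxy hw')
    intro x' hx' hx'y
    exact hw'.uniq x' (by rwa [h3]) hx'y

lemma not_thin_entry (hb : ¬ HasBicontraction E) (hT : Thick E a b)
    (hmin₁ : ∀ a' b' X', Thick E a' b' → Witness E a' b' X' → X.card ≤ X'.card)
    {α β : V} (hα : α ∉ X) (hβ : β ∈ Y) (hαβ : (α, β) ∈ E) (hd : deg (flip E) β = 2) :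
    deg E α = 2 := by
  by_contra hdα
  obtain ⟨s, hs, hsβ⟩ := hS.cover β hβ
  have hne : s ≠ α := fun hh => hα (hh ▸ hs)
  have hds : deg E s = 2 := by
    by_contra hds
    exact hb ⟨s, α, β, hsβ, hαβ, hne, hd, by tauto⟩
  have has : a ≠ s := by rintro rfl; have := hT.2.1; omega
  have hsub : nbrs E (X.erase s) ⊆ (nbrs E X).erase β := by
    refine subset_erase.2 ⟨nbrs_mono (erase_subset _ _), fun hc => ?_⟩
    obtain ⟨x, hx, hxβ⟩ := mem_nbrs.1 hc
    rw [mem_erase] at hx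
    rcases eq_or_eq_of_mem hsβ hαβ hne hd hxβ with rfl | rfl
    · exact hx.1 rfl
    · exact hα hx.2
  have hw' : Witness E a b (X.erase s) := by
    refine ⟨(erase_subset _ _).trans hS.sub, ?_, mem_erase.2 ⟨has, hS.mem⟩, ?_, ?_⟩
    · intro hc
      have : s ∈ X.erase s := by rw [hc]; exact hS.sub hs
      simp at this
    · refine (card_le_card hsub).trans ?_
      rw [card_erase_of_mem (mem_nbrs.2 ⟨s, hs, hsβ⟩), card_erase_of_mem hs, hS.card_nbrs]
      omega
    · intro x hx
      exact hS.witness.uniq x (mem_of_mem_erase hx)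
  have h1 := hmin₁ a b _ hT hw'
  have h2 := card_erase_add_one hs
  omega

lemma exists_disjoint_witness (h : MinHall E) (hb : ¬ HasBicontraction E) (hT : Thick E a b)
    (hmin₁ : ∀ a' b' X', Thick E a' b' → Witness E a' b' X' → X.card ≤ X'.card)
    (hmin₂ : ∀ a' b' X', Thick E a' b' → Witness E a' b' X' → X.card ≤ (left E).card - X'.card)
    {α β : V} (hα : α ∉ X) (hβ : β ∈ Y) (hαβ : (α, β) ∈ E) :
    ∃ X', Witness E α β X' ∧ Disjoint X X' ∧ ∀ y ∈ Y, y ∈ nbrs E X' → y = β := by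
  have hβX : β ∈ nbrs E X := by rw [hS.nbrs_eq]; exact mem_insert_of_mem hβ
  have hαL : α ∈ left E := mem_left.2 ⟨_, hαβ⟩
  obtain ⟨X', hw, hdis⟩ : ∃ X', Witness E α β X' ∧ Disjoint X X' := by
    by_cases hdα : deg E α = 2
    · refine ⟨{α}, ⟨by simpa using ⟨_, hαβ⟩, ?_, by simp, ?_, by simp⟩, by simpa using hα⟩
      · intro hc; have := h.two_le; rw [← hc] at this; simp at this
      · rw [card_singleton]; exact hdα.le
    have hdβ : deg (flip E) β ≠ 2 := fun hd =>
      hdα (hS.not_thin_entry hb hT hmin₁ hα hβ hαβ hd)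
    have hth : Thick E α β := by
      have h1 := h.two_le_deg hαL
      have h2 := h.flip.two_le_deg (mem_left.2 ⟨α, mem_flip.2 hαβ⟩)
      exact ⟨hαβ, by omega, by omega⟩
    obtain ⟨X', hw⟩ := h.witness α β hαβ
    refine ⟨X', hw, ?_⟩
    by_contra hdis
    have hi : (X ∩ X').Nonempty := by rwa [← not_disjoint_iff_nonempty_inter]
    by_cases hu : X ∪ X' = left E
    · have h1 := hmin₂ _ _ X' hth hw
      have h2 := card_union_add_card_inter X X'
      rw [hu] at h2
      have h3 := card_pos.2 hi
      have h4 := card_pos.2 ⟨_, hS.mem⟩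
      omega
    · obtain ⟨-, -, h3⟩ := h.uncross hS.sub hw.sub hS.card_nbrs.le hw.card hi hu
      have : β ∈ nbrs E (X ∩ X') := by
        rw [h3, mem_inter]; exact ⟨hβX, mem_nbrs.2 ⟨α, hw.mem, hαβ⟩⟩
      obtain ⟨x, hx, hxβ⟩ := mem_nbrs.1 this
      rw [mem_inter] at hx
      exact hα (hw.uniq x hx.2 hxβ ▸ hx.1)
  refine ⟨X', hw, hdis, ?_⟩
  intro y hy hyX'
  by_contra hne
  have hyX : y ∈ nbrs E X := by rw [hS.nbrs_eq]; exact mem_insert_of_mem hy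
  have h1 := card_union_add_card_inter (nbrs E X) (nbrs E X')
  rw [← nbrs_union, hS.card_nbrs, h.card_nbrs_eq hw] at h1
  have h2 := card_union_of_disjoint hdis
  have hpair : ({y, β} : Finset V) ⊆ nbrs E X ∩ nbrs E X' := by
    intro z hz
    rcases mem_insert.1 hz with rfl | hz
    · exact mem_inter.2 ⟨hyX, hyX'⟩
    · rw [mem_singleton.1 hz]; exact mem_inter.2 ⟨hβX, mem_nbrs.2 ⟨α, hw.mem, hαβ⟩⟩
  by_cases hu : X ∪ X' = left E
  · obtain ⟨s, hsX, hsb⟩ := hS.exists_outer_nbr h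
    have hsX' : s ∈ X' := by
      have : s ∈ X ∪ X' := hu ▸ mem_left.2 ⟨_, hsb⟩
      rw [mem_union] at this
      tauto
    have hb3 : b ∈ nbrs E X ∩ nbrs E X' := mem_inter.2
      ⟨mem_nbrs.2 ⟨a, hS.mem, hS.edge⟩, mem_nbrs.2 ⟨s, hsX', hsb⟩⟩
    have h3 := card_le_card (insert_subset hb3 hpair)
    have hbY := hS.notMem
    rw [card_insert_of_notMem (by
      simp only [mem_insert, mem_singleton]; rintro (rfl | rfl) <;> contradiction),
      card_pair hne] at h3
    have h4 : (nbrs E (X ∪ X')).card = (X ∪ X').card := by rw [hu, h.card_nbrs_left]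
    omega
  · have h3 := card_le_card hpair
    rw [card_pair hne] at h3
    have h4 := h.hall _ (union_subset hS.sub hw.sub) ⟨a, mem_union_left _ hS.mem⟩ hu
    omega

lemma mem_contract (hc : c ∈ Y) : (s, t) ∈ contractShore E X Y a c ↔
    (s ∉ X ∧ t ∉ Y ∧ (s, t) ∈ E) ∨ (t = c ∧ s ∈ inNbrs E X Y) ∨ (s = a ∧ (t = b ∨ t = c)) := by
  simp only [contractShore, mem_image, Prod.exists, Prod.map_apply, Prod.mk.injEq, mem_inNbrs]
  constructor
  · rintro ⟨x, y, hxy, h1, h2⟩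
    split_ifs at h1 h2 with h3 h4 h4
    · exact Or.inr (Or.inr ⟨h1.symm, Or.inr h2.symm⟩)
    · have := hS.out x h3 y hxy
      refine Or.inr (Or.inr ⟨h1.symm, Or.inl ?_⟩)
      grind
    · subst h1 h2; exact Or.inr (Or.inl ⟨rfl, h3, y, h4, hxy⟩)
    · subst h1 h2; exact Or.inl ⟨h3, h4, hxy⟩
  · rintro (⟨h1, h2, h3⟩ | ⟨rfl, h1, y, hy, hsy⟩ | ⟨rfl, rfl | rfl⟩)
    · exact ⟨s, t, h3, by simp [h1], by simp [h2]⟩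
    · exact ⟨s, y, hsy, by simp [h1], by simp [hy]⟩
    · exact ⟨s, t, hS.edge, by simp, by simp [hS.notMem]⟩
    · obtain ⟨x, hx, hxt⟩ := hS.cover t hc
      exact ⟨x, t, hxt, by simp [hx], by simp [hc]⟩

lemma left_contract (hc : c ∈ Y) :
    left (contractShore E X Y a c) = insert a (left E \ X) := by
  ext s
  simp only [mem_left, hS.mem_contract hc, mem_insert, mem_sdiff, mem_inNbrs]
  constructor
  · rintro ⟨t, h | h | h⟩
    · exact Or.inr ⟨⟨t, h.2.2⟩, h.1⟩
    · obtain ⟨-, h1, y, -, h2⟩ := h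
      exact Or.inr ⟨⟨y, h2⟩, h1⟩
    · exact Or.inl h.1
  · rintro (rfl | ⟨⟨t, ht⟩, h1⟩)
    · exact ⟨b, Or.inr (Or.inr ⟨rfl, Or.inl rfl⟩)⟩
    · by_cases h2 : t ∈ Y
      · exact ⟨c, Or.inr (Or.inl ⟨rfl, h1, t, h2, ht⟩)⟩
      · exact ⟨t, Or.inl ⟨h1, h2, ht⟩⟩

lemma left_flip_contract (hc : c ∈ Y) :
    left (flip (contractShore E X Y a c)) = insert c (left (flip E) \ Y) := by
  ext t
  simp only [mem_left, mem_flip, hS.mem_contract hc, mem_insert, mem_sdiff, mem_inNbrs]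
  constructor
  · rintro ⟨s, h | h | h⟩
    · exact Or.inr ⟨⟨s, h.2.2⟩, h.2.1⟩
    · exact Or.inl h.1
    · rcases h.2 with rfl | rfl
      · exact Or.inr ⟨⟨a, hS.edge⟩, hS.notMem⟩
      · exact Or.inl rfl
  · rintro (rfl | ⟨⟨s, hs⟩, h1⟩)
    · exact ⟨a, Or.inr (Or.inr ⟨rfl, Or.inr rfl⟩)⟩
    · by_cases h2 : s ∈ X
      · have := hS.out s h2 t hs
        exact ⟨a, Or.inr (Or.inr ⟨rfl, by tauto⟩)⟩
      · exact ⟨s, Or.inl ⟨h2, h1, hs⟩⟩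

lemma nbrs_contract_of_subset (hc : c ∈ Y) {P : Finset V} (hP : X ⊆ P) :
    nbrs (contractShore E X Y a c) (insert a (P \ X)) = insert c (nbrs E P \ Y) := by
  ext t
  simp only [mem_nbrs, hS.mem_contract hc, mem_insert, mem_sdiff]
  constructor
  · rintro ⟨s, hs, h | h | h⟩
    · refine Or.inr ⟨⟨s, ?_, h.2.2⟩, h.2.1⟩
      rcases hs with rfl | hs
      · exact hP hS.mem
      · exact hs.1
    · exact Or.inl h.1
    · rcases h.2 with rfl | rfl
      · exact Or.inr ⟨⟨a, hP hS.mem, hS.edge⟩, hS.notMem⟩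
      · exact Or.inl rfl
  · rintro (rfl | ⟨⟨s, hsP, hs⟩, h1⟩)
    · exact ⟨a, Or.inl rfl, Or.inr (Or.inr ⟨rfl, Or.inr rfl⟩)⟩
    · by_cases h2 : s ∈ X
      · have := hS.out s h2 t hs
        exact ⟨a, Or.inl rfl, Or.inr (Or.inr ⟨rfl, by tauto⟩)⟩
      · exact ⟨s, Or.inr ⟨hsP, h2⟩, Or.inl ⟨h2, h1, hs⟩⟩

lemma card_nbrs_contract_of_subset (hc : c ∈ Y) {P : Finset V} (hP : X ⊆ P) :
    (nbrs (contractShore E X Y a c) (insert a (P \ X))).card + X.card = (nbrs E P).card + 1 := by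
  have hYP : Y ⊆ nbrs E P := by
    refine Subset.trans ?_ (nbrs_mono hP)
    rw [hS.nbrs_eq]; exact subset_insert _ _
  rw [hS.nbrs_contract_of_subset hc hP, card_insert_of_notMem (by simp [hc]), ← hS.card_eq]
  have := card_sdiff_add_card_eq_card hYP
  omega

lemma card_insert_sdiff {P : Finset V} (hP : X ⊆ P) :
    (insert a (P \ X)).card + X.card = P.card + 1 := by
  rw [card_insert_of_notMem (by simp [hS.mem])]
  have := card_sdiff_add_card_eq_card hP
  omega

lemma nbrs_contract_of_disjoint (hc : c ∈ Y) {P : Finset V} (hP : Disjoint X P) :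
    nbrs (contractShore E X Y a c) P =
      (nbrs E P).image (fun t => if t ∈ Y then c else t) := by
  ext t
  simp only [mem_nbrs, hS.mem_contract hc, mem_image, mem_inNbrs]
  constructor
  · rintro ⟨s, hs, h | h | h⟩
    · exact ⟨t, ⟨s, hs, h.2.2⟩, by simp [h.2.1]⟩
    · obtain ⟨rfl, -, y, hy, hsy⟩ := h
      exact ⟨y, ⟨s, hs, hsy⟩, by simp [hy]⟩
    · exact absurd hs (h.1 ▸ disjoint_left.1 hP hS.mem)
  · rintro ⟨y, ⟨s, hs, hsy⟩, h⟩
    have hsX := disjoint_right.1 hP hs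
    split_ifs at h with h1
    · exact ⟨s, hs, Or.inr (Or.inl ⟨h.symm, hsX, y, h1, hsy⟩)⟩
    · subst h; exact ⟨s, hs, Or.inl ⟨hsX, h1, hsy⟩⟩

lemma card_left_contract (hc : c ∈ Y) :
    (left (contractShore E X Y a c)).card + X.card = (left E).card + 1 := by
  rw [hS.left_contract hc]; exact hS.card_insert_sdiff hS.sub

lemma card_left_flip_contract (hc : c ∈ Y) :
    (left (flip (contractShore E X Y a c))).card + X.card = (left (flip E)).card + 1 := by
  rw [hS.left_flip_contract hc, card_insert_of_notMem (by simp [hc]), ← hS.card_eq]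
  have := card_sdiff_add_card_eq_card hS.right_sub
  omega

lemma minHall_contract (h : MinHall E) (hc : c ∈ Y)
    (hdisj : ∀ α β, α ∉ X → β ∈ Y → (α, β) ∈ E →
      ∃ X', Witness E α β X' ∧ Disjoint X X' ∧ ∀ y ∈ Y, y ∈ nbrs E X' → y = β) :
    MinHall (contractShore E X Y a c) := by
  have hlt : X.card < (left E).card := card_lt_card (hS.sub.ssubset_of_ne hS.ne)
  have hcL := hS.card_left_contract hc
  have hcR := hS.card_left_flip_contract hc
  have haL := hS.sub hS.mem
  have hLc := hS.left_contract hc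
  -- the left vertices of the contraction, split according to whether they meet the shore
  have shape : ∀ P, X ⊆ P → P ⊆ left E → P ≠ left E →
      insert a (P \ X) ⊆ left (contractShore E X Y a c) ∧
        insert a (P \ X) ≠ left (contractShore E X Y a c) := by
    intro P h1 h2 h3
    rw [hLc]
    refine ⟨insert_subset_insert _ (sdiff_subset_sdiff h2 subset_rfl), fun hh => h3 ?_⟩
    refine h2.antisymm fun s hs => ?_
    by_cases hsX : s ∈ X
    · exact h1 hsX
    · have : s ∈ insert a (P \ X) := by rw [hh]; simp [hsX, mem_left.1 hs]
      rcases mem_insert.1 this with rfl | h4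
      · exact h1 hS.mem
      · exact (mem_sdiff.1 h4).1
  have shape' : ∀ P, Disjoint X P → P ⊆ left E → P ⊆ left (contractShore E X Y a c) ∧
      P ≠ left (contractShore E X Y a c) := by
    intro P h1 h2
    rw [hLc]
    refine ⟨fun s hs => mem_insert_of_mem (mem_sdiff.2 ⟨h2 hs, disjoint_right.1 h1 hs⟩), ?_⟩
    rintro rfl
    exact disjoint_left.1 h1 hS.mem (mem_insert_self _ _)
  refine ⟨by have := h.balanced; omega, by omega, ?_, ?_⟩
  · intro P hP hPn hPL
    rw [hLc] at hP
    by_cases haP : a ∈ P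
    · have hP0 : insert a ((X ∪ P.erase a) \ X) = P := by
        ext s
        have h1 := @hP s
        have := hS.mem
        simp only [mem_insert, mem_sdiff, mem_union, mem_erase] at h1 ⊢
        by_cases hsa : s = a
        · simp [hsa, haP]
        · tauto
      have hsubL : X ∪ P.erase a ⊆ left E := by
        refine union_subset hS.sub fun s hs => ?_
        rw [mem_erase] at hs
        have h1 := hP hs.2
        simp only [mem_insert, mem_sdiff] at h1
        tauto
      have h1 := hS.card_nbrs_contract_of_subset hc (P := X ∪ P.erase a) subset_union_left
      have h2 := hS.card_insert_sdiff (P := X ∪ P.erase a) subset_union_left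
      rw [hP0] at h1 h2
      have h3 := h.hall _ hsubL ⟨a, mem_union_left _ hS.mem⟩ (by
        intro hh; apply hPL; rw [hLc, ← hP0, hh])
      omega
    · have hPX : P ⊆ left E \ X := (subset_insert_iff_of_notMem haP).1 hP
      have hdis : Disjoint X P := disjoint_of_subset_right hPX disjoint_sdiff
      have hPsub : P ⊆ left E := hPX.trans sdiff_subset
      rw [hS.nbrs_contract_of_disjoint hc hdis]
      by_cases hm : Disjoint (nbrs E P) Y
      · have : (nbrs E P).image (fun t => if t ∈ Y then c else t) = nbrs E P := by
          conv_rhs => rw [← image_id (s := nbrs E P)]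
          refine image_congr fun t ht => ?_
          simp [disjoint_left.1 hm ht]
        rw [this]
        exact h.hall P hPsub hPn (by rintro rfl; exact haP haL)
      · have h1 : insert c (nbrs E P \ Y) ⊆
            (nbrs E P).image (fun t => if t ∈ Y then c else t) := by
          obtain ⟨y, hy, hyY⟩ := not_disjoint_iff.1 hm
          refine insert_subset (mem_image.2 ⟨y, hy, by simp [hyY]⟩) fun t ht => ?_
          rw [mem_sdiff] at ht
          exact mem_image.2 ⟨t, ht.1, by simp [ht.2]⟩
        refine lt_of_lt_of_le ?_ (card_le_card h1)
        rw [card_insert_of_notMem (by simp [hc]), Nat.lt_succ_iff]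
        have h2 := card_union_of_disjoint hdis
        have h3 : nbrs E (X ∪ P) = insert b (Y ∪ (nbrs E P \ Y)) := by
          rw [nbrs_union, hS.nbrs_eq, insert_union, union_sdiff_self_eq_union]
        have h4 : (Y ∪ (nbrs E P \ Y)).card = X.card + (nbrs E P \ Y).card := by
          rw [card_union_of_disjoint disjoint_sdiff, hS.card_eq]
        by_cases hu : X ∪ P = left E
        · obtain ⟨s, hsX, hsb⟩ := hS.exists_outer_nbr h
          have hsP : s ∈ P := by
            have : s ∈ X ∪ P := hu ▸ mem_left.2 ⟨_, hsb⟩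
            rw [mem_union] at this
            tauto
          rw [insert_eq_of_mem (mem_union_right _ (mem_sdiff.2
            ⟨mem_nbrs.2 ⟨s, hsP, hsb⟩, hS.notMem⟩))] at h3
          have h5 : (nbrs E (X ∪ P)).card = (X ∪ P).card := by rw [hu, h.card_nbrs_left]
          rw [h3] at h5
          omega
        · have h5 := h.hall _ (union_subset hS.sub hPsub) ⟨a, mem_union_left _ hS.mem⟩ hu
          rw [h3] at h5
          have h6 := card_insert_le b (Y ∪ (nbrs E P \ Y))
          omega
  · intro s t hst
    rcases (hS.mem_contract hc).1 hst with ⟨hsX, htY, hE⟩ | ⟨rfl, hs⟩ | ⟨rfl, ht⟩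
    · obtain ⟨X', hw⟩ := h.witness s t hE
      by_cases hu : X ∪ X' = left E
      · refine ⟨left E \ X, (shape' _ disjoint_sdiff sdiff_subset).1,
          (shape' _ disjoint_sdiff sdiff_subset).2, mem_sdiff.2 ⟨mem_left.2 ⟨_, hE⟩, hsX⟩, ?_, ?_⟩
        · refine (card_le_card nbrs_subset).trans ?_
          rw [card_sdiff_of_subset hS.sub]
          have := h.balanced
          omega
        · intro x hx hxt
          rw [mem_sdiff] at hx
          have hxX' : x ∈ X' := by
            have : x ∈ X ∪ X' := hu ▸ hx.1
            rw [mem_union] at this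
            tauto
          rcases (hS.mem_contract hc).1 hxt with h1 | ⟨rfl, -⟩ | ⟨rfl, -⟩
          · exact hw.uniq x hxX' h1.2.2
          · exact absurd hc htY
          · exact absurd hS.mem hx.2
      by_cases hdis : Disjoint X X'
      · refine ⟨X', (shape' _ hdis hw.sub).1, (shape' _ hdis hw.sub).2, hw.mem, ?_, ?_⟩
        · rw [hS.nbrs_contract_of_disjoint hc hdis]
          exact card_image_le.trans hw.card
        · intro x hx hxt
          rcases (hS.mem_contract hc).1 hxt with h1 | ⟨rfl, -⟩ | ⟨rfl, -⟩
          · exact hw.uniq x hx h1.2.2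
          · exact absurd hc htY
          · exact absurd hx (disjoint_left.1 hdis hS.mem)
      · rw [not_disjoint_iff_nonempty_inter] at hdis
        obtain ⟨h1, -, h3⟩ := h.uncross hS.sub hw.sub hS.card_nbrs.le hw.card hdis hu
        have hsub := union_subset hS.sub hw.sub
        refine ⟨insert a ((X ∪ X') \ X), (shape _ subset_union_left hsub hu).1,
          (shape _ subset_union_left hsub hu).2,
          mem_insert_of_mem (mem_sdiff.2 ⟨mem_union_right _ hw.mem, hsX⟩), ?_, ?_⟩
        · have h4 := hS.card_nbrs_contract_of_subset hc (P := X ∪ X') subset_union_left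
          have h5 := hS.card_insert_sdiff (P := X ∪ X') subset_union_left
          omega
        · intro x hx hxt
          have hxX' : x ≠ a → x ∈ X' := by
            intro hxa
            simp only [mem_insert, mem_sdiff, mem_union] at hx
            tauto
          rcases (hS.mem_contract hc).1 hxt with h4 | ⟨rfl, -⟩ | ⟨rfl, rfl | rfl⟩
          · exact hw.uniq x (hxX' (by rintro rfl; exact h4.1 hS.mem)) h4.2.2
          · exact absurd hc htY
          · have : t ∈ nbrs E (X ∩ X') := by
              rw [h3, mem_inter]
              exact ⟨mem_nbrs.2 ⟨x, hS.mem, hS.edge⟩, mem_nbrs.2 ⟨s, hw.mem, hE⟩⟩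
            obtain ⟨z, hz, hzt⟩ := mem_nbrs.1 this
            rw [mem_inter] at hz
            exact absurd (hw.uniq z hz.2 hzt ▸ hz.1) hsX
          · exact absurd hc htY
    · obtain ⟨hsX, y, hy, hsy⟩ := mem_inNbrs.1 hs
      obtain ⟨X', hw, hdis, hun⟩ := hdisj s y hsX hy hsy
      refine ⟨X', (shape' _ hdis hw.sub).1, (shape' _ hdis hw.sub).2, hw.mem, ?_, ?_⟩
      · rw [hS.nbrs_contract_of_disjoint hc hdis]
        exact card_image_le.trans hw.card
      · intro x hx hxt
        rcases (hS.mem_contract hc).1 hxt with h1 | ⟨-, h1⟩ | ⟨rfl, -⟩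
        · exact absurd hc h1.2.1
        · obtain ⟨-, y', hy', hxy'⟩ := mem_inNbrs.1 h1
          have := hun y' hy' (mem_nbrs.2 ⟨x, hx, hxy'⟩)
          exact hw.uniq x hx (this ▸ hxy')
        · exact absurd hx (disjoint_left.1 hdis hS.mem)
    · have hsh : insert s (X \ X) = {s} := by simp
      have h1 := shape X subset_rfl hS.sub hS.ne
      have h2 := hS.card_nbrs_contract_of_subset hc (P := X) subset_rfl
      rw [hsh] at h1 h2
      refine ⟨{s}, h1.1, h1.2, by simp, ?_, by simp⟩
      rw [card_singleton]
      have := hS.card_nbrs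
      omega

lemma deg_contract_self (hc : c ∈ Y) : deg (contractShore E X Y a c) a = 2 := by
  have h1 := hS.card_nbrs_contract_of_subset hc (P := X) subset_rfl
  rw [show insert a (X \ X) = {a} by simp, hS.card_nbrs] at h1
  unfold deg
  omega

omit hS in
lemma injOn_collapse (hinj : ∀ s, s ∉ X → ∀ y ∈ Y, ∀ y' ∈ Y, (s, y) ∈ E → (s, y') ∈ E → y = y')
    (hc : c ∈ Y) (hs : s ∉ X) :
    Set.InjOn (fun t => if t ∈ Y then c else t) {t | (s, t) ∈ E} := by
  intro t ht t' ht' htt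
  have := hinj s hs t
  grind

lemma deg_contract (hinj : ∀ s, s ∉ X → ∀ y ∈ Y, ∀ y' ∈ Y, (s, y) ∈ E → (s, y') ∈ E → y = y')
    (hc : c ∈ Y) (hs : s ∉ X) : deg (contractShore E X Y a c) s = deg E s := by
  rw [deg, hS.nbrs_contract_of_disjoint hc (by simpa using hs), card_image_of_injOn, deg]
  refine (injOn_collapse hinj hc hs).mono fun t ht => ?_
  simpa using ht

lemma deg_flip_contract (hc : c ∈ Y) (ht : t ∉ Y) :
    deg (flip (contractShore E X Y a c)) t = deg (flip E) t := by
  unfold deg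
  congr 1
  ext s
  simp only [mem_nbrs_singleton, mem_flip, hS.mem_contract hc]
  constructor
  · rintro (h | ⟨rfl, -⟩ | ⟨rfl, rfl | rfl⟩)
    · exact h.2.2
    · exact absurd hc ht
    · exact hS.edge
    · exact absurd hc ht
  · intro h
    by_cases hs : s ∈ X
    · have := hS.out s hs t h
      tauto
    · exact Or.inl ⟨hs, ht, h⟩

lemma deg_flip_contract_self (hc : c ∈ Y) :
    deg (flip (contractShore E X Y a c)) c = (inNbrs E X Y).card + 1 := by
  rw [← card_insert_of_notMem (a := a) (s := inNbrs E X Y)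
    (by rw [mem_inNbrs]; exact fun hh => hh.1 hS.mem), deg]
  congr 1
  ext s
  simp only [mem_nbrs_singleton, mem_flip, hS.mem_contract hc, mem_insert]
  tauto

lemma card_contract (hinj : ∀ s, s ∉ X → ∀ y ∈ Y, ∀ y' ∈ Y, (s, y) ∈ E → (s, y') ∈ E → y = y')
    (hc : c ∈ Y) :
    (contractShore E X Y a c).card + (E.filter (·.1 ∈ X)).card = E.card + 2 := by
  have h1 := card_filter_add_card_filter_not (s := contractShore E X Y a c) (·.1 = a)
  rw [← deg_eq_card_filter, hS.deg_contract_self hc] at h1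
  have h2 := card_filter_add_card_filter_not (s := E) (·.1 ∈ X)
  have h3 : (contractShore E X Y a c).filter (¬ ·.1 = a) =
      (E.filter (¬ ·.1 ∈ X)).image (Prod.map id (fun t => if t ∈ Y then c else t)) := by
    ext ⟨s, t⟩
    simp only [mem_filter, hS.mem_contract hc, mem_image, Prod.exists, Prod.map_apply, id,
      Prod.mk.injEq, mem_inNbrs]
    constructor
    · rintro ⟨h | ⟨rfl, h4, y, hy, hsy⟩ | h, hsa⟩
      · exact ⟨s, t, ⟨h.2.2, h.1⟩, rfl, by simp [h.2.1]⟩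
      · exact ⟨s, y, ⟨hsy, h4⟩, rfl, by simp [hy]⟩
      · exact absurd h.1 hsa
    · rintro ⟨x, y, ⟨hxy, hx⟩, rfl, h⟩
      refine ⟨?_, fun hh => hx (hh ▸ hS.mem)⟩
      split_ifs at h with hy
      · exact Or.inr (Or.inl ⟨h.symm, hx, y, hy, hxy⟩)
      · subst h; exact Or.inl ⟨hx, hy, hxy⟩
  rw [h3, card_image_of_injOn] at h1
  · omega
  · rintro ⟨x, y⟩ hx ⟨x', y'⟩ hx' hh
    simp only [mem_coe, mem_filter, Prod.map_apply, id, Prod.mk.injEq] at hx hx' hh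
    obtain ⟨rfl, hh⟩ := hh
    rw [injOn_collapse hinj hc hx.2 hx.1 hx'.1 hh]

lemma numTwo_contract_le
    (hinj : ∀ s, s ∉ X → ∀ y ∈ Y, ∀ y' ∈ Y, (s, y) ∈ E → (s, y') ∈ E → y = y') (hc : c ∈ Y) :
    numTwo (contractShore E X Y a c) + (X.filter (deg E · = 2)).card ≤ numTwo E + 1 := by
  have h1 : numTwo E = (X.filter (deg E · = 2)).card + ((left E \ X).filter (deg E · = 2)).card := by
    rw [numTwo, ← card_union_of_disjoint (disjoint_filter_filter disjoint_sdiff), ← filter_union,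
      union_sdiff_of_subset hS.sub]
  have h2 : numTwo (contractShore E X Y a c) ≤ ((left E \ X).filter (deg E · = 2)).card + 1 := by
    rw [numTwo, hS.left_contract hc]
    refine (card_le_card ?_).trans (card_insert_le a _)
    intro s hs
    simp only [mem_filter, mem_insert, mem_sdiff] at hs ⊢
    rcases hs.1 with rfl | h3
    · exact Or.inl rfl
    · rw [hS.deg_contract hinj hc h3.2] at hs
      tauto
  omega

lemma numTwo_flip_contract_le (hc : c ∈ Y) :
    numTwo (flip (contractShore E X Y a c)) + (Y.filter (deg (flip E) · = 2)).card ≤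
      numTwo (flip E) + if (inNbrs E X Y).card = 1 then 1 else 0 := by
  have h1 : numTwo (flip E) = (Y.filter (deg (flip E) · = 2)).card +
      ((left (flip E) \ Y).filter (deg (flip E) · = 2)).card := by
    rw [numTwo, ← card_union_of_disjoint (disjoint_filter_filter disjoint_sdiff), ← filter_union,
      union_sdiff_of_subset hS.right_sub]
  have h2 : numTwo (flip (contractShore E X Y a c)) ≤
      ((left (flip E) \ Y).filter (deg (flip E) · = 2)).card +
        if (inNbrs E X Y).card = 1 then 1 else 0 := by
    rw [numTwo, hS.left_flip_contract hc]
    have h3 : ((left (flip E) \ Y).filter (deg (flip (contractShore E X Y a c)) · = 2)) =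
        (left (flip E) \ Y).filter (deg (flip E) · = 2) := by
      refine filter_congr fun t ht => ?_
      rw [hS.deg_flip_contract hc (mem_sdiff.1 ht).2]
    rw [filter_insert, h3, hS.deg_flip_contract_self hc]
    split_ifs with h4 h5 h5
    · exact card_insert_le _ _
    · omega
    · omega
    · omega
  omega

end IsShore

lemma card_filter_deg_eq_two :
    ((E.filter (·.1 ∈ X)).filter (deg E ·.1 = 2)).card =
      2 * (X.filter (deg E · = 2)).card := by
  rw [card_eq_sum_card_fiberwise (f := Prod.fst) (t := X.filter (deg E · = 2)), mul_comm]
  · refine sum_const_nat fun x hx => ?_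
    rw [mem_filter] at hx
    refine Eq.trans ?_ hx.2
    rw [deg_eq_card_filter]
    congr 1
    ext p
    simp only [mem_filter]
    constructor
    · rintro ⟨⟨⟨h3, -⟩, -⟩, h5⟩; exact ⟨h3, h5⟩
    · rintro ⟨h3, rfl⟩; exact ⟨⟨⟨h3, hx.1⟩, hx.2⟩, rfl⟩
  · intro p hp
    simp only [mem_coe, mem_filter] at hp ⊢
    exact ⟨hp.1.2, hp.2⟩

lemma exists_mixed_nbrs (hb : ¬ HasBicontraction (flip E)) (hd : deg E s = 2) :
    (∃ t, (s, t) ∈ E ∧ deg (flip E) t = 2) ∧ (∃ t, (s, t) ∈ E ∧ deg (flip E) t ≠ 2) := by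
  obtain ⟨t₁, t₂, hne, ht⟩ := card_eq_two.1 hd
  have h1 : (s, t₁) ∈ E := mem_nbrs_singleton.1 (by rw [ht]; simp)
  have h2 : (s, t₂) ∈ E := mem_nbrs_singleton.1 (by rw [ht]; simp)
  have h3 : ¬ (deg (flip E) t₁ = 2 ↔ deg (flip E) t₂ = 2) := fun hh =>
    hb ⟨t₁, t₂, s, mem_flip.2 h1, mem_flip.2 h2, hne, by rwa [flip_flip], hh⟩
  by_cases h4 : deg (flip E) t₁ = 2
  · exact ⟨⟨t₁, h1, h4⟩, ⟨t₂, h2, by tauto⟩⟩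
  · exact ⟨⟨t₂, h2, by tauto⟩, ⟨t₁, h1, h4⟩⟩

lemma card_two_le_of_nbrs (hb : ¬ HasBicontraction E) (hb' : ¬ HasBicontraction (flip E))
    {Z : Finset V} (hZ : ∀ x ∈ X, deg E x = 2 → ∀ t, (x, t) ∈ E → deg (flip E) t = 2 → t ∈ Z) :
    (X.filter (deg E · = 2)).card ≤ (Z.filter (deg (flip E) · = 2)).card := by
  refine card_le_card_of_forall_subsingleton (fun s t => (s, t) ∈ E) ?_ ?_
  · intro x hx
    rw [mem_filter] at hx
    obtain ⟨⟨t, h1, h2⟩, -⟩ := exists_mixed_nbrs hb' hx.2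
    exact ⟨t, mem_filter.2 ⟨hZ x hx.1 hx.2 t h1 h2, h2⟩, h1⟩
  · intro t ht x hx y hy
    simp only [mem_filter, Set.mem_ofPred_eq] at ht hx hy
    by_contra hne
    exact hb ⟨x, y, t, hx.2, hy.2, hne, ht.2, by simp [hx.1.2, hy.1.2]⟩

namespace IsShore

variable {c : V}

/-- The right vertices of the shore that are ends of thick edges inside the shore. -/
def thickEnds (E : Finset (V × V)) (X Y : Finset V) : Finset V :=
  Y.filter fun y => deg (flip E) y ≠ 2 ∧ ∃ x ∈ X, deg E x ≠ 2 ∧ (x, y) ∈ E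

variable (hS : IsShore E a b X Y) (h : MinHall E) (hb : ¬ HasBicontraction E)
    (hb' : ¬ HasBicontraction (flip E)) (hT : Thick E a b)
    (hmin₁ : ∀ a' b' X', Thick E a' b' → Witness E a' b' X' → X.card ≤ X'.card)
    (hmin₂ : ∀ a' b' X', Thick E a' b' → Witness E a' b' X' → X.card ≤ (left E).card - X'.card)

include hS h hb hT hmin₁ hmin₂ in
lemma card_filter_le : (E.filter (·.1 ∈ X)).card ≤ 2 * (X.filter (deg E · = 2)).card +
    (Y.filter (deg (flip E) · = 2)).card + (thickEnds E X Y).card + 1 := by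
  have h1 := card_filter_add_card_filter_not (s := E.filter (·.1 ∈ X)) (deg E ·.1 = 2)
  have h2 := card_filter_add_card_filter_not
    (s := (E.filter (·.1 ∈ X)).filter (¬ deg E ·.1 = 2)) (deg (flip E) ·.2 = 2)
  have h3 := card_filter_deg_eq_two (E := E) (X := X)
  have h4 : (((E.filter (·.1 ∈ X)).filter (¬ deg E ·.1 = 2)).filter (deg (flip E) ·.2 = 2)).card ≤
      (Y.filter (deg (flip E) · = 2)).card := by
    refine card_le_card_of_injOn Prod.snd ?_ ?_
    · rintro ⟨x, y⟩ hp
      simp only [mem_coe, mem_filter] at hp ⊢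
      refine ⟨?_, hp.2⟩
      rcases hS.out x hp.1.1.2 y hp.1.1.1 with h5 | ⟨-, rfl⟩
      · exact h5
      · have := hT.2.2; omega
    · rintro ⟨x, y⟩ hp ⟨x', y'⟩ hp' hh
      simp only [mem_coe, mem_filter] at hp hp' hh
      subst hh
      by_contra hne
      exact hb ⟨x, x', y, hp.1.1.1, hp'.1.1.1, fun hx => hne (by rw [hx]), hp.2,
        by simp [hp.1.2, hp'.1.2]⟩
  have h5 : (((E.filter (·.1 ∈ X)).filter (¬ deg E ·.1 = 2)).filter
      (¬ deg (flip E) ·.2 = 2)).card ≤ (thickEnds E X Y).card + 1 := by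
    refine le_trans ?_ (card_insert_le b _)
    refine card_le_card_of_injOn Prod.snd ?_ ?_
    · rintro ⟨x, y⟩ hp
      simp only [mem_coe, mem_filter, mem_insert, thickEnds] at hp ⊢
      rcases hS.out x hp.1.1.2 y hp.1.1.1 with h5 | ⟨-, rfl⟩
      · exact Or.inr ⟨h5, hp.2, x, hp.1.1.2, hp.1.2, hp.1.1.1⟩
      · exact Or.inl rfl
    · rintro ⟨x, y⟩ hp ⟨x', y'⟩ hp' hh
      simp only [mem_coe, mem_filter] at hp hp' hh
      subst hh
      have h6 := h.two_le_deg (mem_left.2 ⟨y, hp.1.1.1⟩)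
      have h7 := h.flip.two_le_deg (mem_left.2 ⟨x, mem_flip.2 hp.1.1.1⟩)
      rw [hS.uniq_of_thick h hmin₁ hmin₂ ⟨hp.1.1.1, by omega, by omega⟩ hp.1.1.2 x' hp'.1.1.2
        hp'.1.1.1]
  omega

include hS h hb' hT hmin₁ hmin₂ in
lemma two_le_or_card_lt : 2 ≤ (X.filter (¬ deg E · = 2)).card ∨
    (thickEnds E X Y).card < (Y.filter (¬ deg (flip E) · = 2)).card := by
  by_contra! hcon
  have hsub : thickEnds E X Y ⊆ Y.filter (¬ deg (flip E) · = 2) :=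
    fun y hy => by
      simp only [thickEnds, mem_filter] at hy ⊢
      exact ⟨hy.1, hy.2.1⟩
  have heq := eq_of_subset_of_card_le hsub hcon.2
  have hall : ∀ x ∈ X, deg E x ≠ 2 := by
    intro x hx hd
    obtain ⟨-, y, hxy, hy⟩ := exists_mixed_nbrs hb' hd
    have hyY : y ∈ Y := by
      rcases hS.out x hx y hxy with h1 | ⟨rfl, -⟩
      · exact h1
      · have := hT.2.1; omega
    have hy' : y ∈ thickEnds E X Y := by rw [heq, mem_filter]; exact ⟨hyY, hy⟩
    simp only [thickEnds, mem_filter] at hy'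
    obtain ⟨-, -, x', hx', hd', hx'y⟩ := hy'
    have h6 := h.two_le_deg (mem_left.2 ⟨y, hx'y⟩)
    have h7 := h.flip.two_le_deg (mem_left.2 ⟨x, mem_flip.2 hxy⟩)
    have := hS.uniq_of_thick h hmin₁ hmin₂ (x := x') (y := y) ⟨hx'y, by omega, by omega⟩ hx' x hx hxy
    rw [this] at hd
    exact hd' hd
  rw [filter_true_of_mem hall] at hcon
  have hX : X = {a} := by
    refine (eq_of_subset_of_card_le (singleton_subset_iff.2 hS.mem) ?_).symm
    rw [card_singleton]; omega
  have h1 := hS.card_nbrs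
  have h2 := hT.2.1
  rw [hX, card_singleton] at h1
  unfold deg at h2
  omega

lemma inCut_of_inCut_contract (hS : IsShore E a b X Y)
    (hinj : ∀ s, s ∉ X → ∀ y ∈ Y, ∀ y' ∈ Y, (s, y) ∈ E → (s, y') ∈ E → y = y') (hc : c ∈ Y)
    (hk : (inNbrs E X Y).card = 1) {a' b' : V} (ha' : a' ∉ X) (hb' : b' ∉ Y)
    (hcut : InCut (contractShore E X Y a c) a' b') : InCut E a' b' := by
  obtain ⟨c', d', hT, hne, P, Q, h1, h2⟩ := hcut
  have hdc : deg (flip (contractShore E X Y a c)) c = 2 := by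
    rw [hS.deg_flip_contract_self hc, hk]
  have hda := hS.deg_contract_self hc
  have hc'a : c' ≠ a := by rintro rfl; have := hT.2.1; omega
  have hd'c : d' ≠ c := by rintro rfl; have := hT.2.2; omega
  obtain ⟨hc'X, hd'Y, hcd⟩ : c' ∉ X ∧ d' ∉ Y ∧ (c', d') ∈ E := by
    have := (hS.mem_contract hc).1 hT.1
    tauto
  refine ⟨c', d', ⟨hcd, ?_, ?_⟩, hne, {s | (if s ∈ X then a else s) ∈ P},
    {t | (if t ∈ Y then c else t) ∈ Q}, ?_, ?_⟩
  · rw [← hS.deg_contract hinj hc hc'X]; exact hT.2.1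
  · rw [← hS.deg_flip_contract hc hd'Y]; exact hT.2.2
  · intro s t hst
    have h3 := h1 _ _ (mem_image_of_mem
      (Prod.map (fun s => if s ∈ X then a else s) (fun t => if t ∈ Y then c else t)) hst)
    rw [Set.mem_ofPred_eq, Set.mem_ofPred_eq, h3]
    have haX := hS.mem
    simp only [Prod.mk.injEq]
    grind
  · simpa [ha', hb', hc'X, hd'Y] using h2

lemma cross_iff (hS : IsShore E a b X Y) {α β : V} (hα : α ∉ X) (hβ : β ∈ Y)
    (hin : ∀ s t, (s, t) ∈ E → s ∉ X → t ∈ Y → s = α ∧ t = β) (hst : (s, t) ∈ E) :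
    ¬ (s ∈ (X : Set V) ↔ t ∈ (Y : Set V)) ↔ (s, t) = (a, b) ∨ (s, t) = (α, β) := by
  have h1 := hin s t hst
  simp only [mem_coe, Prod.mk.injEq]
  constructor
  · intro hh
    by_cases hs : s ∈ X
    · have := hS.out s hs t hst
      tauto
    · tauto
  · rintro (⟨rfl, rfl⟩ | ⟨rfl, rfl⟩) hh
    · exact hS.notMem (hh.1 hS.mem)
    · exact hα (hh.2 hβ)

set_option maxHeartbeats 1000000 in
include hS h hb hb' hT hmin₁ hmin₂ in
/-- A minimum shore can be contracted to an edge without increasing the excess. -/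
lemma exists_smaller : ∃ E' : Finset (V × V), MinHall E' ∧ (left E').card < (left E).card ∧
    excess E' ≤ excess E ∧ (excess E = excess E' →
      (HasBicontraction E' ∧ 3 ≤ (left E').card) ∨ ∀ a' b', Thick E a' b' →
        InCut E a' b' ∨ (Thick E' a' b' ∧ (InCut E' a' b' → InCut E a' b'))) := by
  obtain ⟨c, hc⟩ : Y.Nonempty := by
    rw [← card_pos, hS.card_eq]; exact card_pos.2 ⟨a, hS.mem⟩
  have hdisj := fun α β hα hβ hαβ =>
    hS.exists_disjoint_witness h hb hT hmin₁ hmin₂ (α := α) (β := β) hα hβ hαβ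
  have hinj : ∀ s, s ∉ X → ∀ y ∈ Y, ∀ y' ∈ Y, (s, y) ∈ E → (s, y') ∈ E → y = y' := by
    intro s hs y hy y' hy' h1 h2
    obtain ⟨X', hw, -, h3⟩ := hdisj s y hs hy h1
    exact (h3 y' hy' (mem_nbrs.2 ⟨s, hw.mem, h2⟩)).symm
  have hM := hS.minHall_contract h hc hdisj
  have hL := hS.card_left_contract hc
  have hR := hS.card_left_flip_contract hc
  have hm := hS.card_contract hinj hc
  have hn := hS.numTwo_contract_le hinj hc
  have hn' := hS.numTwo_flip_contract_le hc
  have hin := hS.card_filter_le h hb hT hmin₁ hmin₂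
  have hor := hS.two_le_or_card_lt h hb' hT hmin₁ hmin₂
  have hXY : ∀ x ∈ X, deg E x = 2 → ∀ t, (x, t) ∈ E → t ∈ Y := by
    intro x hx hd t hxt
    rcases hS.out x hx t hxt with h1 | ⟨rfl, -⟩
    · exact h1
    · have := hT.2.1; omega
  have hx2 := card_two_le_of_nbrs hb hb' (X := X) (Z := Y) fun x hx hd t hxt _ => hXY x hx hd t hxt
  have hx := card_filter_add_card_filter_not (s := X) (deg E · = 2)
  have hy := card_filter_add_card_filter_not (s := Y) (deg (flip E) · = 2)
  have hx3 : 1 ≤ (X.filter (¬ deg E · = 2)).card :=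
    card_pos.2 ⟨a, mem_filter.2 ⟨hS.mem, by have := hT.2.1; omega⟩⟩
  have hthick : (thickEnds E X Y).card ≤ (Y.filter (¬ deg (flip E) · = 2)).card :=
    card_le_card fun y hy => by
      simp only [thickEnds, mem_filter] at hy ⊢
      exact ⟨hy.1, hy.2.1⟩
  have hcardY := hS.card_eq
  have hX2 : 2 ≤ X.card := by
    by_contra hX1
    have h1 := h.card_nbrs_eq hS.witness
    have h2 : X = {a} := by
      refine (eq_of_subset_of_card_le (singleton_subset_iff.2 hS.mem) ?_).symm
      rw [card_singleton]; omega
    have h3 := hT.2.1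
    rw [h2, card_singleton] at h1
    unfold deg at h3
    omega
  refine ⟨_, hM, by omega, ?_, ?_⟩
  · unfold excess
    split_ifs at hn' <;> omega
  intro heq
  unfold excess at heq
  have hk : (inNbrs E X Y).card = 1 := by
    by_contra hk
    rw [if_neg hk] at hn'
    omega
  rw [if_pos hk] at hn'
  obtain ⟨α, hα⟩ := card_eq_one.1 hk
  have hα' : α ∈ inNbrs E X Y := by rw [hα]; simp
  obtain ⟨hαX, β, hβ, hαβ⟩ := mem_inNbrs.1 hα'
  have hin_eq : ∀ s t, (s, t) ∈ E → s ∉ X → t ∈ Y → s = α ∧ t = β := by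
    intro s t hst hs ht
    have h1 : s ∈ inNbrs E X Y := mem_inNbrs.2 ⟨hs, t, ht, hst⟩
    rw [hα, mem_singleton] at h1
    subst h1
    exact ⟨rfl, hinj s hs t ht β hβ hst hαβ⟩
  have hdβ : deg (flip E) β ≠ 2 := by
    intro hdβ
    have hdα := hS.not_thin_entry hb hT hmin₁ hαX hβ hαβ hdβ
    have h1 := card_two_le_of_nbrs hb hb' (X := X) (Z := Y.erase β) (by
      intro x hx hd t hxt _
      refine mem_erase.2 ⟨?_, hXY x hx hd t hxt⟩
      rintro rfl
      exact hb ⟨x, α, t, hxt, hαβ, fun hh => hαX (hh ▸ hx), hdβ, by simp [hd, hdα]⟩)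
    rw [filter_erase] at h1
    have h2 := card_erase_add_one (s := Y.filter (deg (flip E) · = 2)) (a := β)
      (mem_filter.2 ⟨hβ, hdβ⟩)
    omega
  by_cases hdα : deg E α = 2
  · left
    refine ⟨⟨a, α, c, ?_, ?_, ?_, ?_, ?_⟩, ?_⟩
    · rw [hS.mem_contract hc]; tauto
    · rw [hS.mem_contract hc]; tauto
    · rintro rfl; exact hαX hS.mem
    · rw [hS.deg_flip_contract_self hc, hk]
    · rw [hS.deg_contract_self hc, hS.deg_contract hinj hc hαX, hdα]
    · have h1 := hT.2.2
      rw [← hS.deg_flip_contract hc hS.notMem] at h1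
      refine h1.trans (card_le_card ?_)
      simpa using nbrs_subset (E := flip (contractShore E X Y a c)) (X := {b})
  right
  have hTf : Thick E α β := by
    have h6 := h.two_le_deg (mem_left.2 ⟨β, hαβ⟩)
    have h7 := h.flip.two_le_deg (mem_left.2 ⟨α, mem_flip.2 hαβ⟩)
    exact ⟨hαβ, by omega, by omega⟩
  have hcross := fun s t hst => hS.cross_iff hαX hβ hin_eq (s := s) (t := t) hst
  intro a' b' hT'
  by_cases haX : a' ∈ X <;> by_cases hbY : b' ∈ Y
  · exfalso
    have h1 : nbrs (flip E) {b'} ⊆ {a', α} := by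
      intro x hx
      rw [mem_nbrs_singleton, mem_flip] at hx
      rw [mem_insert, mem_singleton]
      by_cases hxX : x ∈ X
      · exact Or.inl (hS.uniq_of_thick h hmin₁ hmin₂ hT' haX x hxX hx)
      · exact Or.inr (hin_eq x b' hx hxX hbY).1
    have h2 := card_le_card h1
    have h3 := card_le_two (a := a') (b := α)
    have h4 := hT'.2.2
    unfold deg at h4
    omega
  · left
    obtain ⟨rfl, rfl⟩ : a' = a ∧ b' = b := by
      have := hS.out a' haX b' hT'.1
      tauto
    refine ⟨α, β, hTf, ?_, X, Y, hcross, Or.inl ⟨hS.mem, hβ⟩⟩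
    intro hh
    simp only [Prod.mk.injEq] at hh
    exact hαX (hh.1 ▸ haX)
  · left
    obtain ⟨rfl, rfl⟩ := hin_eq a' b' hT'.1 haX hbY
    refine ⟨a, b, hT, ?_, X, Y, ?_, Or.inr ⟨hbY, hS.mem⟩⟩
    · intro hh
      simp only [Prod.mk.injEq] at hh
      exact haX (hh.1 ▸ hS.mem)
    · intro s t hst
      rw [hcross s t hst, or_comm]
  · right
    refine ⟨⟨?_, ?_, ?_⟩, hS.inCut_of_inCut_contract hinj hc hk haX hbY⟩
    · rw [hS.mem_contract hc]; exact Or.inl ⟨haX, hbY, hT'.1⟩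
    · rw [hS.deg_contract hinj hc haX]; exact hT'.2.1
    · rw [hS.deg_flip_contract hc hbY]; exact hT'.2.2

end IsShore

lemma numTwo_le_numTwo_flip (hb : ¬ HasBicontraction E) (hb' : ¬ HasBicontraction (flip E)) :
    numTwo E ≤ numTwo (flip E) :=
  card_two_le_of_nbrs hb hb' fun x _ _ _ hxt _ => mem_left.2 ⟨x, mem_flip.2 hxt⟩

namespace MinHall

lemma excess_eq_zero_of_card_eq_two (h : MinHall E) (hL : (left E).card = 2) : excess E = 0 := by
  have key : ∀ {F : Finset (V × V)}, MinHall F → (left F).card = 2 → numTwo F = 2 ∧ F.card = 4 := by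
    intro F hF hLF
    have hd : ∀ s ∈ left F, deg F s = 2 := fun s hs =>
      le_antisymm (hLF ▸ hF.balanced ▸ card_le_card nbrs_subset) (hF.two_le_deg hs)
    have h1 := card_filter_deg_eq_two (E := F) (X := left F)
    have h2 : F.filter (·.1 ∈ left F) = F :=
      filter_true_of_mem fun p hp => mem_left.2 ⟨p.2, hp⟩
    rw [h2, filter_true_of_mem fun p hp => hd p.1 (mem_left.2 ⟨p.2, hp⟩)] at h1
    rw [numTwo, filter_true_of_mem hd]
    rw [filter_true_of_mem hd] at h1
    omega
  obtain ⟨h1, h2⟩ := key h hL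
  obtain ⟨h3, -⟩ := key h.flip (h.balanced ▸ hL)
  have := h.balanced
  unfold excess
  omega

lemma not_thick_of_card_eq_two (h : MinHall E) (hL : (left E).card = 2) : ¬ Thick E a b := by
  intro hT
  have h1 : deg E a ≤ 2 := hL ▸ h.balanced ▸ card_le_card nbrs_subset
  have := hT.2.1
  omega

/-- The excess is nonnegative when no edge is thick. -/
lemma excess_nonneg_of_forall_not_thick (h : MinHall E) (hb : ¬ HasBicontraction E)
    (hb' : ¬ HasBicontraction (BipartiteEdges.flip E)) (hT : ∀ a b, ¬ Thick E a b) :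
    0 ≤ excess E := by
  have h1 := numTwo_le_numTwo_flip hb hb'
  have h2 : numTwo (BipartiteEdges.flip E) ≤ numTwo E := by
    simpa using numTwo_le_numTwo_flip hb' (by simpa using hb)
  have hthin : ∀ s t, (s, t) ∈ E → deg E s ≠ 2 → deg (BipartiteEdges.flip E) t = 2 := by
    intro s t hst hs
    have h3 := h.two_le_deg (mem_left.2 ⟨t, hst⟩)
    have h4 := h.flip.two_le_deg (mem_left.2 ⟨s, mem_flip.2 hst⟩)
    have := hT s t
    unfold Thick at this
    by_contra h5
    exact this ⟨hst, by omega, by omega⟩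
  have h3 := card_filter_deg_eq_two (E := E) (X := left E)
  rw [filter_true_of_mem fun p hp => mem_left.2 ⟨p.2, hp⟩] at h3
  have h4 := card_filter_add_card_filter_not (s := E) (deg E ·.1 = 2)
  have h5 : (E.filter (¬ deg E ·.1 = 2)).card ≤ numTwo (BipartiteEdges.flip E) := by
    refine card_le_card_of_injOn Prod.snd ?_ ?_
    · rintro ⟨x, y⟩ hp
      simp only [mem_coe, mem_filter] at hp ⊢
      exact ⟨mem_left.2 ⟨x, mem_flip.2 hp.1⟩, hthin x y hp.1 hp.2⟩
    · rintro ⟨x, y⟩ hp ⟨x', y'⟩ hp' hh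
      simp only [mem_coe, mem_filter] at hp hp' hh
      subst hh
      by_contra hne
      exact hb ⟨x, x', y, hp.1, hp'.1, fun hx => hne (by rw [hx]), hthin x y hp.1 hp.2,
        by simp [hp.2, hp'.2]⟩
  have h6 : numTwo E < (left E).card := by
    obtain ⟨s, hs⟩ : (left E).Nonempty := card_pos.1 (by have := h.two_le; omega)
    obtain ⟨s', hs', hd⟩ : ∃ s ∈ left E, deg E s ≠ 2 := by
      by_cases hd : deg E s = 2
      · obtain ⟨⟨t, ht, hdt⟩, -⟩ := exists_mixed_nbrs hb' hd
        obtain ⟨-, s', hs', hd'⟩ :=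
          exists_mixed_nbrs (E := BipartiteEdges.flip E) (by simpa using hb) hdt
        exact ⟨s', mem_left.2 ⟨t, mem_flip.1 hs'⟩, by simpa using hd'⟩
      · exact ⟨s, hs, hd⟩
    exact card_lt_card ((filter_subset _ _).ssubset_of_ne fun hh =>
      hd (mem_filter.1 (hh.ge hs')).2)
  have := h.balanced
  change _ = 2 * numTwo E at h3
  unfold excess
  omega

/-- The induction step through a thick edge whose witness is smallest on both sides. -/
lemma inCut_of_exists_smaller (h : MinHall E)
    (ih : ∀ E' : Finset (V × V), MinHall E' → (left E').card < (left E).card →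
      0 ≤ excess E' ∧ (excess E' = 0 → ∀ a b, Thick E' a b → InCut E' a b))
    (hb : ¬ HasBicontraction E) (hb' : ¬ HasBicontraction (BipartiteEdges.flip E))
    (hT : Thick E a b) (hw : Witness E a b X)
    (hmin : ∀ a' b' X', Thick E a' b' → Witness E a' b' X' → X.card ≤ X'.card)
    (hmin' : ∀ a' b' X', Thick E a' b' → Witness E a' b' X' → X.card ≤ (left E).card - X'.card) :
    0 ≤ excess E ∧ (excess E = 0 → ∀ a b, Thick E a b → InCut E a b) := by
  obtain ⟨E', hE', hlt, hle, heq⟩ :=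
    (h.isShore hT.1 hw).exists_smaller h hb hb' hT hmin hmin'
  obtain ⟨h1, h2⟩ := ih E' hE' hlt
  refine ⟨h1.trans hle, fun h0 a' b' hT' => ?_⟩
  have h0' : excess E' = 0 := by omega
  rcases heq (by omega) with ⟨h3, h4⟩ | h3
  · obtain ⟨E'', hE'', hlt', hlt''⟩ := h3.exists_smaller hE' h4
    have := (ih E'' hE'' (by omega)).1
    omega
  · rcases h3 a' b' hT' with h4 | ⟨h4, h5⟩
    · exact h4
    · exact h5 (h2 h0' a' b' h4)

/-- The excess is nonnegative, and in the extremal case every thick edge lies in a balanced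
2-cut with another thick edge. -/
theorem excess_nonneg_and_inCut (E : Finset (V × V)) (h : MinHall E) :
    0 ≤ excess E ∧ (excess E = 0 → ∀ a b, Thick E a b → InCut E a b) := by
  induction hn : (left E).card using Nat.strong_induction_on generalizing E with
  | _ n ih =>
  subst hn
  replace ih : ∀ E' : Finset (V × V), MinHall E' → (left E').card < (left E).card →
      0 ≤ excess E' ∧ (excess E' = 0 → ∀ a b, Thick E' a b → InCut E' a b) :=
    fun E' hE' hlt => ih _ hlt E' hE' rfl
  by_cases hL : (left E).card = 2
  · exact ⟨(h.excess_eq_zero_of_card_eq_two hL).ge,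
      fun _ a b hT => (h.not_thick_of_card_eq_two hL hT).elim⟩
  have hL3 : 3 ≤ (left E).card := by have := h.two_le; omega
  by_cases hb : HasBicontraction E
  · obtain ⟨E', hE', hlt, hex⟩ := hb.exists_smaller h hL3
    have := (ih E' hE' hlt).1
    exact ⟨by omega, fun h0 => by omega⟩
  by_cases hb' : HasBicontraction (BipartiteEdges.flip E)
  · obtain ⟨E', hE', hlt, hex⟩ := hb'.exists_smaller h.flip (h.balanced ▸ hL3)
    have := (ih E' hE' (h.balanced ▸ hlt)).1
    rw [excess_flip] at hex
    exact ⟨by omega, fun h0 => by omega⟩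
  by_cases hT : ∀ a b, ¬ Thick E a b
  · exact ⟨h.excess_nonneg_of_forall_not_thick hb hb' hT, fun _ a b hab => (hT a b hab).elim⟩
  push Not at hT
  obtain ⟨a₀, b₀, hT₀⟩ := hT
  obtain ⟨X₀, hw₀⟩ := h.witness a₀ b₀ hT₀.1
  have hex : ∃ k, ∃ a b X, Thick E a b ∧ Witness E a b X ∧
      (X.card = k ∨ (left E).card - X.card = k) := ⟨_, a₀, b₀, X₀, hT₀, hw₀, Or.inl rfl⟩
  classical
  obtain ⟨a, b, X, hTab, hw, hk⟩ := Nat.find_spec hex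
  have hmin : ∀ a' b' X', Thick E a' b' → Witness E a' b' X' →
      Nat.find hex ≤ X'.card ∧ Nat.find hex ≤ (left E).card - X'.card := fun a' b' X' h1 h2 =>
    ⟨Nat.find_min' hex ⟨a', b', X', h1, h2, Or.inl rfl⟩,
      Nat.find_min' hex ⟨a', b', X', h1, h2, Or.inr rfl⟩⟩
  rcases hk with hk | hk
  · rw [← hk] at hmin
    exact h.inCut_of_exists_smaller ih hb hb' hTab hw (fun _ _ _ h1 h2 => (hmin _ _ _ h1 h2).1)
      (fun _ _ _ h1 h2 => (hmin _ _ _ h1 h2).2)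
  · obtain ⟨hw', hc⟩ := h.witness_flip hTab.1 hw
    rw [← hk, ← hc] at hmin
    have hmin' : ∀ b' a' X', Thick (BipartiteEdges.flip E) b' a' →
        Witness (BipartiteEdges.flip E) b' a' X' →
        (left (BipartiteEdges.flip E) \ (nbrs E X).erase b).card ≤ X'.card ∧
          (left (BipartiteEdges.flip E) \ (nbrs E X).erase b).card ≤
            (left (BipartiteEdges.flip E)).card - X'.card := fun b' a' X' h1 h2 => by
      obtain ⟨h3, h4⟩ := h.flip.witness_flip h1.1 h2
      rw [flip_flip] at h3 h4
      have h5 := hmin _ _ _ (thick_flip.1 h1) h3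
      have h6 := card_le_card h2.sub
      have h7 := h.balanced
      omega
    obtain ⟨h1, h2⟩ := h.flip.inCut_of_exists_smaller
      (fun E' hE' hlt => ih E' hE' (h.balanced ▸ hlt)) hb' (by simpa using hb)
      (thick_flip.2 hTab) hw' (fun _ _ _ h1 h2 => (hmin' _ _ _ h1 h2).1)
      (fun _ _ _ h1 h2 => (hmin' _ _ _ h1 h2).2)
    rw [excess_flip] at h1 h2
    exact ⟨h1, fun h0 a b hT => (h2 h0 b a (thick_flip.2 hT)).of_flip⟩

end MinHall

section Graph

variable {G : SimpleGraph V} {A B : Finset V}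

/-- `A` and `B` form a bipartition of the graph `G`. -/
structure IsBip (G : SimpleGraph V) (A B : Finset V) : Prop where
  part : ∀ v, v ∈ A ↔ v ∉ B
  adj : ∀ u v, G.Adj u v → (u ∈ A ∧ v ∈ B) ∨ (u ∈ B ∧ v ∈ A)

open Classical in
/-- The edges of `G` between `A` and `B`, as ordered pairs. -/
noncomputable def biEdges (G : SimpleGraph V) (A B : Finset V) : Finset (V × V) :=
  (A ×ˢ B).filter fun p => G.Adj p.1 p.2

omit [DecidableEq V] in
@[simp] lemma mem_biEdges : (s, t) ∈ biEdges G A B ↔ (s ∈ A ∧ t ∈ B) ∧ G.Adj s t := by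
  simp [biEdges]

@[simp] lemma flip_biEdges : flip (biEdges G A B) = biEdges G B A := by
  ext ⟨s, t⟩
  simp only [mem_flip, mem_biEdges, G.adj_comm s t]
  tauto

lemma nbrs_biEdges_subset : nbrs (biEdges G A B) X ⊆ B := by
  intro t ht
  obtain ⟨s, -, hs⟩ := mem_nbrs.1 ht
  exact (mem_biEdges.1 hs).1.2

lemma left_biEdges_subset : left (biEdges G A B) ⊆ A := by
  intro s hs
  obtain ⟨t, ht⟩ := mem_left.1 hs
  exact (mem_biEdges.1 ht).1.1

namespace IsBip

lemma symm (h : IsBip G A B) : IsBip G B A where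
  part v := by have := h.part v; tauto
  adj u v huv := (h.adj u v huv).symm

omit [DecidableEq V] in
lemma mono {G' : SimpleGraph V} (h : IsBip G A B) (hle : G' ≤ G) : IsBip G' A B :=
  ⟨h.part, fun u v huv => h.adj u v (hle huv)⟩

lemma mem_right (h : IsBip G A B) (hs : s ∈ A) (hst : G.Adj s t) : t ∈ B := by
  have := h.adj s t hst
  have := h.part s
  tauto

lemma mem_edges (h : IsBip G A B) (hs : s ∈ A) (hst : G.Adj s t) : (s, t) ∈ biEdges G A B :=
  mem_biEdges.2 ⟨⟨hs, h.mem_right hs hst⟩, hst⟩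

omit [DecidableEq V] in
lemma disjoint (h : IsBip G A B) : Disjoint A B :=
  disjoint_left.2 fun v hv => (h.part v).1 hv

lemma card_add_card [Fintype V] (h : IsBip G A B) : A.card + B.card = Fintype.card V := by
  rw [← card_union_of_disjoint h.disjoint, ← card_univ]
  congr 1
  ext v
  have := h.part v
  simp only [mem_union, mem_univ, iff_true]
  tauto

lemma deg_eq (h : IsBip G A B) (hs : s ∈ A) : deg (biEdges G A B) s = degN G s := by
  rw [deg, degN, ← Set.ncard_coe_finset]
  congr 1
  ext t
  simp only [mem_coe, mem_nbrs_singleton, mem_neighborSet]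
  exact ⟨fun h' => (mem_biEdges.1 h').2, h.mem_edges hs⟩

omit [DecidableEq V] in
lemma card_edges (h : IsBip G A B) : (biEdges G A B).card = G.edgeSet.ncard := by
  rw [← Set.ncard_coe_finset, ← Set.InjOn.ncard_image (f := fun p : V × V => s(p.1, p.2))]
  · congr 1
    ext e
    induction e with
    | _ u v =>
    simp only [Set.mem_image, mem_coe, Prod.exists, mem_biEdges, mem_edgeSet]
    constructor
    · rintro ⟨s, t, ⟨-, hst⟩, he⟩
      rwa [← mem_edgeSet, ← he]
    · intro huv
      rcases h.adj u v huv with h1 | h1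
      · exact ⟨u, v, ⟨h1, huv⟩, rfl⟩
      · exact ⟨v, u, ⟨h1.symm, huv.symm⟩, Sym2.eq_swap⟩
  · rintro ⟨s, t⟩ hst ⟨s', t'⟩ hst' he
    simp only [mem_coe, mem_biEdges] at hst hst'
    rcases Sym2.eq_iff.1 he with ⟨h1, h2⟩ | ⟨h1, h2⟩
    · exact Prod.ext h1 h2
    · simp only at h1 h2
      subst h1
      exact ((h.part s).1 hst.1.1 hst'.1.2).elim

end IsBip

omit [DecidableEq V] in
lemma exists_involution {M : G.Subgraph} (hM : M.IsPerfectMatching) :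
    ∃ f : V → V, (∀ v, M.Adj v (f v)) ∧ (∀ v, f (f v) = v) ∧ ∀ v w, M.Adj v w → f v = w := by
  rw [Subgraph.isPerfectMatching_iff] at hM
  choose f hf hu using hM
  exact ⟨f, hf, fun v => (hu _ _ (hf v).symm).symm, fun v w hvw => (hu v w hvw).symm⟩

omit [DecidableEq V] in
lemma forall_of_connected (hG : G.Connected) {p : V → Prop} (hs : p s)
    (hstep : ∀ u v, G.Adj u v → p u → p v) (v : V) : p v := by
  obtain ⟨w⟩ := hG.preconnected s v
  induction w with
  | nil => exact hs
  | cons hadj _ ih => exact ih (hstep _ _ hadj hs)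

variable [Fintype V]

omit [DecidableEq V] in
lemma exists_adj_of_matchingCovered (hG : MatchingCovered G) (v : V) : ∃ w, G.Adj v w := by
  have : Nontrivial V := Fintype.one_lt_card_iff_nontrivial.1 (by have := hG.2.1; omega)
  exact hG.1.preconnected.exists_adj_of_nontrivial v

lemma IsBip.left_eq (h : IsBip G A B) (hG : MatchingCovered G) : left (biEdges G A B) = A := by
  refine left_biEdges_subset.antisymm fun s hs => ?_
  obtain ⟨t, ht⟩ := exists_adj_of_matchingCovered hG s
  exact mem_left.2 ⟨t, h.mem_edges hs ht⟩

lemma IsBip.card_le (h : IsBip G A B) (hG : MatchingCovered G) : A.card ≤ B.card := by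
  rcases A.eq_empty_or_nonempty with rfl | ⟨v, -⟩
  · simp
  obtain ⟨w, hw⟩ := exists_adj_of_matchingCovered hG v
  obtain ⟨M, hM, -⟩ := hG.2.2 _ (G.mem_edgeSet.2 hw)
  obtain ⟨f, h1, h2, -⟩ := exists_involution hM
  exact card_le_card_of_injOn f (fun s hs => h.mem_right hs (h1 s).adj_sub)
    (Function.LeftInverse.injective h2).injOn

lemma IsBip.card_eq (h : IsBip G A B) (hG : MatchingCovered G) : A.card = B.card :=
  (h.card_le hG).antisymm (h.symm.card_le hG)

/-- Matching covered bipartite graphs satisfy the strict Hall condition. -/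
lemma IsBip.card_lt_card_nbrs (h : IsBip G A B) (hG : MatchingCovered G) (hX : X ⊆ A)
    (hne : X.Nonempty) (hXA : X ≠ A) : X.card < (nbrs (biEdges G A B) X).card := by
  by_contra! hcon
  obtain ⟨x₀, hx₀⟩ := hne
  have key : ∀ s t, G.Adj s t → t ∈ nbrs (biEdges G A B) X → s ∈ X := by
    intro s t hst ht
    obtain ⟨M, hM, hMe⟩ := hG.2.2 _ (G.mem_edgeSet.2 hst)
    obtain ⟨f, h1, h2, h3⟩ := exists_involution hM
    have hsub : X.image f ⊆ nbrs (biEdges G A B) X := by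
      intro y hy
      obtain ⟨x, hx, rfl⟩ := mem_image.1 hy
      exact mem_nbrs.2 ⟨x, hx, h.mem_edges (hX hx) (h1 x).adj_sub⟩
    have heq := eq_of_subset_of_card_le hsub (by
      rwa [card_image_of_injective _ (Function.LeftInverse.injective h2)])
    rw [← heq, mem_image] at ht
    obtain ⟨x, hx, rfl⟩ := ht
    have h4 : f (f x) = s := h3 _ _ (Subgraph.mem_edgeSet.1 hMe).symm
    rw [h2] at h4
    exact h4 ▸ hx
  have hall : ∀ v, v ∈ X ∨ v ∈ nbrs (biEdges G A B) X := by
    refine forall_of_connected hG.1 (s := x₀) (Or.inl hx₀) ?_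
    rintro u v huv (hu | hu)
    · exact Or.inr (mem_nbrs.2 ⟨u, hu, h.mem_edges (hX hu) huv⟩)
    · exact Or.inl (key v u huv.symm hu)
  refine hXA (hX.antisymm fun s hs => ?_)
  rcases hall s with h1 | h1
  · exact h1
  · exact ((h.part s).1 hs (nbrs_biEdges_subset h1)).elim

variable (h : IsBip G A B) (hc : A.card = B.card)
    (hall : ∀ X ⊆ A, X.Nonempty → X ≠ A → X.card < (nbrs (biEdges G A B) X).card)

omit [Fintype V] in
include hall in
/-- Under the strict Hall condition every edge extends to a bijection between the classes. -/
lemma exists_injOn_of_hall (hab : (a, b) ∈ biEdges G A B) :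
    ∃ f : V → V, (∀ s ∈ A, (s, f s) ∈ biEdges G A B) ∧ Set.InjOn f A ∧ f a = b := by
  set E := biEdges G A B with hE
  have haA : a ∈ A := (mem_biEdges.1 hab).1.1
  let T : A → Finset V := fun x => if (x : V) = a then {b} else (nbrs E {(x : V)}).erase b
  have hT : ∀ S : Finset A, S.card ≤ (S.biUnion T).card := by
    intro S
    set X := S.image Subtype.val with hX
    have hXc : X.card = S.card := card_image_of_injective _ Subtype.val_injective
    have hXA : X ⊆ A := by
      intro x hx
      obtain ⟨y, -, rfl⟩ := mem_image.1 hx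
      exact y.2
    have h1 : (X.erase a).card ≤ ((nbrs E (X.erase a)).erase b).card := by
      rcases (X.erase a).eq_empty_or_nonempty with he | hne
      · rw [he]; simp
      · have := hall (X.erase a) ((erase_subset _ _).trans hXA) hne
          fun hh => notMem_erase a X (hh ▸ haA)
        have := pred_card_le_card_erase (s := nbrs E (X.erase a)) (a := b)
        omega
    have h2 : (nbrs E (X.erase a)).erase b ⊆ S.biUnion T := by
      intro t ht
      obtain ⟨htb, ht⟩ := mem_erase.1 ht
      obtain ⟨s, hs, hst⟩ := mem_nbrs.1 ht
      obtain ⟨hsa, hs⟩ := mem_erase.1 hs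
      obtain ⟨y, hy, rfl⟩ := mem_image.1 hs
      refine mem_biUnion.2 ⟨y, hy, ?_⟩
      simp only [T, if_neg hsa]
      exact mem_erase.2 ⟨htb, mem_nbrs_singleton.2 hst⟩
    by_cases ha : a ∈ X
    · have h3 : b ∈ S.biUnion T := by
        obtain ⟨y, hy, rfl⟩ := mem_image.1 ha
        exact mem_biUnion.2 ⟨y, hy, by simp [T]⟩
      have h4 := card_le_card (insert_subset h3 h2)
      rw [card_insert_of_notMem (notMem_erase _ _)] at h4
      have := card_erase_add_one ha
      omega
    · rw [erase_eq_of_notMem ha] at h1 h2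
      have := card_le_card h2
      omega
  obtain ⟨g, hg, hgT⟩ := (all_card_le_biUnion_card_iff_exists_injective T).1 hT
  have hfa : ∀ hh : a ∈ A, g ⟨a, hh⟩ = b := fun hh => by
    have := hgT ⟨a, hh⟩
    simpa [T] using this
  refine ⟨fun v => if hv : v ∈ A then g ⟨v, hv⟩ else v, fun s hs => ?_, fun s hs t ht hst => ?_, ?_⟩
  · simp only [dif_pos hs]
    by_cases hsa : s = a
    · subst hsa; rw [hfa]; exact hab
    · have := hgT ⟨s, hs⟩
      simp only [T, if_neg hsa] at this
      exact mem_nbrs_singleton.1 (mem_of_mem_erase this)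
  · simp only [dif_pos (mem_coe.1 hs), dif_pos (mem_coe.1 ht)] at hst
    exact congrArg Subtype.val (hg hst)
  · simp [haA, hfa]

omit [Fintype V] in
include h hc hall in
lemma exists_perfectMatching_of_hall (hab : (a, b) ∈ biEdges G A B) :
    ∃ M : G.Subgraph, M.IsPerfectMatching ∧ s(a, b) ∈ M.edgeSet := by
  obtain ⟨f, hf, hinj, hfa⟩ := exists_injOn_of_hall hall hab
  have hadj : ∀ s ∈ A, G.Adj s (f s) := fun s hs => (mem_biEdges.1 (hf s hs)).2
  have hB : ∀ s ∈ A, f s ∈ B := fun s hs => (mem_biEdges.1 (hf s hs)).1.2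
  have hsurj : ∀ t ∈ B, ∃ s ∈ A, f s = t := by
    have := eq_of_subset_of_card_le (s := A.image f) (t := B)
      (by intro t ht; obtain ⟨s, hs, rfl⟩ := mem_image.1 ht; exact hB s hs)
      (by rw [card_image_of_injOn hinj, hc])
    intro t ht
    rw [← this, mem_image] at ht
    exact ht
  refine ⟨{ verts := Set.univ
            Adj := fun u v => (u ∈ A ∧ f u = v) ∨ (v ∈ A ∧ f v = u)
            adj_sub := ?_
            edge_vert := fun _ => Set.mem_univ _
            symm := ⟨fun _ _ => Or.symm⟩ }, ?_, ?_⟩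
  · rintro u v (⟨hu, rfl⟩ | ⟨hv, rfl⟩)
    · exact hadj u hu
    · exact (hadj v hv).symm
  · rw [Subgraph.isPerfectMatching_iff]
    intro v
    have hv := h.part v
    by_cases hvA : v ∈ A
    · refine ⟨f v, Or.inl ⟨hvA, rfl⟩, ?_⟩
      rintro w (⟨-, rfl⟩ | ⟨hw, hwv⟩)
      · rfl
      · exact (hv.1 hvA (hwv ▸ hB w hw)).elim
    · obtain ⟨s, hs, hsv⟩ := hsurj v (by tauto)
      refine ⟨s, Or.inr ⟨hs, hsv⟩, ?_⟩
      rintro w (⟨hvA', -⟩ | ⟨hw, hwv⟩)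
      · exact (hvA hvA').elim
      · exact hinj hw hs (hwv.trans hsv.symm)
  · exact Or.inl ⟨(mem_biEdges.1 hab).1.1, hfa⟩

include h hc hall in
lemma connected_of_hall (h4 : 4 ≤ Fintype.card V) : G.Connected := by
  have hAB := h.card_add_card
  obtain ⟨a₀, ha₀⟩ : A.Nonempty := card_pos.1 (by omega)
  classical
  set C := A.filter (G.Reachable a₀) with hC
  set D := B.filter (G.Reachable a₀) with hD
  have h1 : nbrs (biEdges G A B) C ⊆ D := by
    intro t ht
    obtain ⟨s, hs, hst⟩ := mem_nbrs.1 ht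
    exact mem_filter.2 ⟨nbrs_biEdges_subset ht, (mem_filter.1 hs).2.trans (mem_biEdges.1 hst).2.reachable⟩
  have h2 : nbrs (biEdges G A B) (A \ C) ⊆ B \ D := by
    intro t ht
    refine mem_sdiff.2 ⟨nbrs_biEdges_subset ht, fun htD => ?_⟩
    obtain ⟨s, hs, hst⟩ := mem_nbrs.1 ht
    rw [mem_sdiff] at hs
    exact hs.2 (mem_filter.2 ⟨hs.1, (mem_filter.1 htD).2.trans
      (mem_biEdges.1 hst).2.symm.reachable⟩)
  have ha₀C : a₀ ∈ C := mem_filter.2 ⟨ha₀, Reachable.refl _⟩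
  have hCA : C = A := by
    by_contra hne
    have h3 := hall C (filter_subset _ _) ⟨a₀, ha₀C⟩ hne
    have h5 := hall (A \ C) sdiff_subset
      (sdiff_nonempty.2 fun hh => hne ((filter_subset _ _).antisymm hh))
      (fun hh => (mem_sdiff.1 (hh.ge ha₀)).2 ha₀C)
    have h6 := card_le_card h1
    have h7 := card_le_card h2
    have h8 := card_sdiff_add_card_eq_card (show C ⊆ A from filter_subset _ _)
    have h9 := card_sdiff_add_card_eq_card (show D ⊆ B from filter_subset _ _)
    omega
  have hDB : D = B := by
    refine eq_of_subset_of_card_le (filter_subset _ _) ?_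
    have h3 := hall (A.erase a₀) (erase_subset _ _)
      (card_pos.1 (by rw [card_erase_of_mem ha₀]; omega)) (fun hh => notMem_erase a₀ A (hh.ge ha₀))
    rw [card_erase_of_mem ha₀] at h3
    have h5 := card_le_card (h1.trans' (nbrs_mono ((erase_subset a₀ A).trans hCA.ge)))
    omega
  rw [connected_iff_exists_forall_reachable]
  refine ⟨a₀, fun v => ?_⟩
  by_cases hv : v ∈ A
  · exact (mem_filter.1 (hCA.ge hv)).2
  · exact (mem_filter.1 (hDB.ge (by have := h.part v; tauto))).2

include h hc hall in
/-- Balanced bipartite graphs satisfying the strict Hall condition are matching covered. -/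
lemma matchingCovered_of_hall (h4 : 4 ≤ Fintype.card V) : MatchingCovered G := by
  refine ⟨connected_of_hall h hc hall h4, h4, fun e he => ?_⟩
  induction e with
  | _ u v =>
  rw [mem_edgeSet] at he
  rcases h.adj u v he with h1 | h1
  · exact exists_perfectMatching_of_hall h hc hall (mem_biEdges.2 ⟨h1, he⟩)
  · rw [Sym2.eq_swap]
    exact exists_perfectMatching_of_hall h hc hall (mem_biEdges.2 ⟨h1.symm, he.symm⟩)

include h in
lemma exists_witness (hG : MinimalMatchingCovered G) (hab : (a, b) ∈ biEdges G A B) :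
    ∃ X, Witness (biEdges G A B) a b X := by
  have hadj := (mem_biEdges.1 hab).2
  have hG' := hG.2 _ (G.mem_edgeSet.2 hadj)
  have hE : ∀ s t, (s, t) ∈ biEdges (G.deleteEdges {s(a, b)}) A B ↔
      (s, t) ∈ biEdges G A B ∧ ¬ (s = a ∧ t = b) := by
    intro s t
    simp only [mem_biEdges, deleteEdges_adj, Set.mem_singleton_iff, Sym2.eq_iff]
    have h1 := h.part s
    have h2 : b ∈ B := (mem_biEdges.1 hab).1.2
    constructor
    · tauto
    · rintro ⟨⟨h3, h4⟩, h5⟩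
      refine ⟨h3, h4, ?_⟩
      rintro (h6 | ⟨rfl, rfl⟩)
      · exact h5 h6
      · tauto
  obtain ⟨X, hXA, hne, hXA', hX⟩ : ∃ X ⊆ A, X.Nonempty ∧ X ≠ A ∧
      (nbrs (biEdges (G.deleteEdges {s(a, b)}) A B) X).card ≤ X.card := by
    by_contra! hcon
    exact hG' (matchingCovered_of_hall (h.mono (deleteEdges_le _)) (h.card_eq hG.1) hcon hG.1.2.1)
  have hlt := h.card_lt_card_nbrs hG.1 hXA hne hXA'
  have hnot : ∀ x ∈ X, (x, b) ∈ biEdges G A B → x = a := by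
    intro x hx hxb
    by_contra hxa
    have : nbrs (biEdges G A B) X ⊆ nbrs (biEdges (G.deleteEdges {s(a, b)}) A B) X := by
      intro t ht
      obtain ⟨s, hs, hst⟩ := mem_nbrs.1 ht
      by_cases htb : t = b
      · subst htb
        exact mem_nbrs.2 ⟨x, hx, (hE x t).2 ⟨hxb, by tauto⟩⟩
      · exact mem_nbrs.2 ⟨s, hs, (hE s t).2 ⟨hst, by tauto⟩⟩
    have := card_le_card this
    omega
  have haX : a ∈ X := by
    by_contra haX
    have : nbrs (biEdges G A B) X ⊆ nbrs (biEdges (G.deleteEdges {s(a, b)}) A B) X := by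
      intro t ht
      obtain ⟨s, hs, hst⟩ := mem_nbrs.1 ht
      exact mem_nbrs.2 ⟨s, hs, (hE s t).2 ⟨hst, fun hh => haX (hh.1 ▸ hs)⟩⟩
    have := card_le_card this
    omega
  refine ⟨X, (h.left_eq hG.1).symm ▸ hXA, (h.left_eq hG.1).symm ▸ hXA', haX, ?_, hnot⟩
  have : nbrs (biEdges G A B) X ⊆
      insert b (nbrs (biEdges (G.deleteEdges {s(a, b)}) A B) X) := by
    intro t ht
    obtain ⟨s, hs, hst⟩ := mem_nbrs.1 ht
    by_cases htb : t = b
    · exact mem_insert.2 (Or.inl htb)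
    · exact mem_insert_of_mem (mem_nbrs.2 ⟨s, hs, (hE s t).2 ⟨hst, by tauto⟩⟩)
  have := (card_le_card this).trans (card_insert_le _ _)
  omega

lemma IsBip.minHall (h : IsBip G A B) (hG : MinimalMatchingCovered G) :
    MinHall (biEdges G A B) where
  balanced := by
    rw [flip_biEdges, h.left_eq hG.1, h.symm.left_eq hG.1, h.card_eq hG.1]
  two_le := by
    rw [h.left_eq hG.1]
    have := h.card_add_card
    have := h.card_eq hG.1
    have := hG.1.2.1
    omega
  hall X hX hne hXL := by
    rw [h.left_eq hG.1] at hX hXL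
    exact h.card_lt_card_nbrs hG.1 hX hne hXL
  witness a b hab := exists_witness h hG hab

lemma IsBip.excess_eq_zero (h : IsBip G A B) (hG : MatchingCovered G)
    (hext : {v | degN G v = 2}.ncard + 2 * Fintype.card V = 2 * G.edgeSet.ncard + 4) :
    excess (biEdges G A B) = 0 := by
  have h1 : numTwo (biEdges G A B) + numTwo (flip (biEdges G A B)) =
      {v | degN G v = 2}.ncard := by
    rw [flip_biEdges, numTwo, numTwo, h.left_eq hG, h.symm.left_eq hG,
      filter_congr (fun s hs => by rw [h.deg_eq hs]),
      filter_congr (s := B) (fun s hs => by rw [h.symm.deg_eq hs]),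
      ← card_union_of_disjoint (disjoint_filter_filter h.disjoint), ← Set.ncard_coe_finset]
    congr 1
    ext v
    have := h.part v
    simp only [coe_union, coe_filter, Set.mem_union, Set.mem_ofPred_eq]
    tauto
  have h2 := h.card_add_card
  unfold excess
  rw [flip_biEdges] at *
  rw [h.left_eq hG, h.symm.left_eq hG, h.card_edges]
  omega

/-- The balanced 2-cut property, for an edge whose first end lies in `A`. -/
lemma IsBip.exists_edgeCut (h : IsBip G A B) (hG : MinimalMatchingCovered G)
    (hext : {v | degN G v = 2}.ncard + 2 * Fintype.card V = 2 * G.edgeSet.ncard + 4)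
    (hab : G.Adj a b) (ha : a ∈ A) (hda : 3 ≤ degN G a) (hdb : 3 ≤ degN G b) :
    ∃ c d, (c ∈ A ∧ d ∈ B) ∧ G.Adj c d ∧ 3 ≤ degN G c ∧ 3 ≤ degN G d ∧ s(c, d) ≠ s(a, b) ∧
      ∃ W : Set V, W ≠ Set.univ ∧ edgeCut G W = {s(a, b), s(c, d)} ∧
        ((a ∈ W ∧ d ∈ W) ∨ (b ∈ W ∧ c ∈ W)) := by
  have hb := h.mem_right ha hab
  have hE := h.mem_edges ha hab
  have hT : Thick (biEdges G A B) a b :=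
    ⟨hE, by rwa [h.deg_eq ha], by rwa [flip_biEdges, h.symm.deg_eq hb]⟩
  obtain ⟨c, d, hT', hne, P, Q, hcut, hPQ⟩ :=
    (h.minHall hG).excess_nonneg_and_inCut.2 (h.excess_eq_zero hG.1 hext) a b hT
  obtain ⟨⟨hc, hd⟩, hcd⟩ := mem_biEdges.1 hT'.1
  have hdc := hT'.2.1
  have hdd := hT'.2.2
  rw [h.deg_eq hc] at hdc
  rw [flip_biEdges, h.symm.deg_eq hd] at hdd
  set W : Set V := {v | (v ∈ A ∧ v ∈ P) ∨ (v ∈ B ∧ v ∈ Q)} with hW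
  have hWA : ∀ s ∈ A, (s ∈ W ↔ s ∈ P) := fun s hs => by
    have := (h.part s).1 hs
    simp only [hW, Set.mem_ofPred_eq]
    tauto
  have hWB : ∀ t ∈ B, (t ∈ W ↔ t ∈ Q) := fun t ht => by
    have := h.part t
    simp only [hW, Set.mem_ofPred_eq]
    tauto
  have hWcut : ∀ s t, (s, t) ∈ biEdges G A B →
      (¬ (s ∈ W ↔ t ∈ W) ↔ (s, t) = (a, b) ∨ (s, t) = (c, d)) := fun s t hst => by
    have := (mem_biEdges.1 hst).1
    rw [hWA s this.1, hWB t this.2, hcut s t hst]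
  have hmem : ∀ s t, (s, t) ∈ biEdges G A B → ¬ (s ∈ W ↔ t ∈ W) → s(s, t) ∈ edgeCut G W := by
    intro s t hst hst'
    have hadj := (mem_biEdges.1 hst).2
    by_cases hs : s ∈ W
    · exact ⟨hadj, s, t, rfl, hs, fun ht => hst' (iff_of_true hs ht)⟩
    · exact ⟨hadj, t, s, Sym2.eq_swap, not_not.1 fun ht => hst' (iff_of_false hs ht), hs⟩
  have hWab := (hWcut a b hE).2 (Or.inl rfl)
  refine ⟨c, d, ⟨hc, hd⟩, hcd, hdc, hdd, ?_, W, ?_, ?_, ?_⟩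
  · intro heq
    rcases Sym2.eq_iff.1 heq with ⟨rfl, rfl⟩ | ⟨rfl, rfl⟩
    · exact hne rfl
    · exact (h.part _).1 hc hb
  · intro hWu
    simp [hWu] at hWab
  · apply Set.Subset.antisymm
    · rintro _ ⟨he, u, v, rfl, hu, hv⟩
      rw [mem_edgeSet] at he
      rcases h.adj u v he with h1 | h1
      · rcases (hWcut u v (mem_biEdges.2 ⟨h1, he⟩)).1 (by tauto) with h2 | h2 <;>
        · simp only [Prod.mk.injEq] at h2
          simp [h2]
      · rcases (hWcut v u (mem_biEdges.2 ⟨h1.symm, he.symm⟩)).1 (by tauto) with h2 | h2 <;>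
        · simp only [Prod.mk.injEq] at h2
          rw [Sym2.eq_swap]
          simp [h2]
    · rintro e (rfl | rfl)
      · exact hmem a b hE hWab
      · exact hmem c d hT'.1 ((hWcut c d hT'.1).2 (Or.inr rfl))
  · rwa [hWA a ha, hWA c hc, hWB b hb, hWB d hd]

end Graph

end BipartiteEdges

/-- Balanced 2-cut property: in a 2-vertex extremal minimal bipartite matching covered graph,
every edge whose two ends both have degree at least 3 lies in a 2-cut `{e, f}` together with
another such edge `f`, and the ends of `e` and `f` inside the cut's shore lie in different
classes of the bipartition. -/
theorem stmt15 {V : Type*} [Fintype V] (G : SimpleGraph V)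
    (A B : Set V) (hpart : ∀ v, v ∈ A ↔ v ∉ B)
    (hbip : ∀ u v, G.Adj u v → (u ∈ A ∧ v ∈ B) ∨ (u ∈ B ∧ v ∈ A))
    (hmin : MinimalMatchingCovered G)
    (hext : {v | degN G v = 2}.ncard + 2 * Fintype.card V = 2 * G.edgeSet.ncard + 4)
    (a b : V) (hab : G.Adj a b) (hda : 3 ≤ degN G a) (hdb : 3 ≤ degN G b) :
    ∃ c d : V, G.Adj c d ∧ 3 ≤ degN G c ∧ 3 ≤ degN G d ∧ s(c, d) ≠ s(a, b) ∧
      ∃ Wset : Set V, Wset.Nonempty ∧ Wset ≠ Set.univ ∧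
        edgeCut G Wset = {s(a, b), s(c, d)} ∧
        ∃ x y : V, x ∈ ({a, b} : Set V) ∧ y ∈ ({c, d} : Set V) ∧ x ∈ Wset ∧ y ∈ Wset ∧
          ((x ∈ A ∧ y ∈ B) ∨ (x ∈ B ∧ y ∈ A)) := by
  classical
  have hG : BipartiteEdges.IsBip G A.toFinset B.toFinset :=
    ⟨fun v => by simpa using hpart v, fun u v huv => by simpa using hbip u v huv⟩
  rcases hbip a b hab with ⟨ha, hb⟩ | ⟨ha, hb⟩
  · obtain ⟨c, d, ⟨hc, hd⟩, hcd, hdc, hdd, hne, W, hWu, hcut, hW⟩ :=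
      hG.exists_edgeCut hmin hext hab (by simpa using ha) hda hdb
    rw [Set.mem_toFinset] at hc hd
    refine ⟨c, d, hcd, hdc, hdd, hne, W, ?_, hWu, hcut, ?_⟩
    · rcases hW with hW | hW
      exacts [⟨a, hW.1⟩, ⟨b, hW.1⟩]
    · rcases hW with hW | hW
      · exact ⟨a, d, by simp, by simp, hW.1, hW.2, Or.inl ⟨ha, hd⟩⟩
      · exact ⟨b, c, by simp, by simp, hW.1, hW.2, Or.inr ⟨hb, hc⟩⟩
  · obtain ⟨c, d, ⟨hc, hd⟩, hcd, hdc, hdd, hne, W, hWu, hcut, hW⟩ :=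
      hG.exists_edgeCut hmin hext hab.symm (by simpa using hb) hdb hda
    rw [Set.mem_toFinset] at hc hd
    rw [Sym2.eq_swap (a := b)] at hne hcut
    refine ⟨c, d, hcd, hdc, hdd, hne, W, ?_, hWu, hcut, ?_⟩
    · rcases hW with hW | hW
      exacts [⟨b, hW.1⟩, ⟨a, hW.1⟩]
    · rcases hW with hW | hW
      · exact ⟨b, d, by simp, by simp, hW.1, hW.2, Or.inl ⟨hb, hd⟩⟩
      · exact ⟨a, c, by simp, by simp, hW.1, hW.2, Or.inr ⟨ha, hc⟩⟩
end

section
/- Let k ≥ 1 and let G be a minimal bipartite k-extendable graph. Then the number of vertices of G of degree exactly k+1 is at least (m − n + 1)/k; that is, k·|V_{k+1}| + n ≥ m + 1, where n is the number of vertices, m the number of edges, and V_{k+1} the set of vertices of degree exactly k+1 of G. -/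
open SimpleGraph

/-- A matching of `G` given as a set of edges of `G`, no two of which share an endpoint. -/
def IsMatchingSet {V : Type*} (G : SimpleGraph V) (F : Set (Sym2 V)) : Prop :=
  F ⊆ G.edgeSet ∧ ∀ e₁ ∈ F, ∀ e₂ ∈ F, e₁ ≠ e₂ → ∀ u ∈ e₁, u ∉ e₂

/-- `G` is `k`-extendable: connected, of order at least `2k+2`, has a matching of `k` edges,
and every matching of `k` edges is contained in a perfect matching of `G`. -/
def KExtendable {V : Type*} [Fintype V] (G : SimpleGraph V) (k : ℕ) : Prop :=
  G.Connected ∧ 2 * k + 2 ≤ Fintype.card V ∧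
    (∃ F : Set (Sym2 V), IsMatchingSet G F ∧ F.ncard = k) ∧
    ∀ F : Set (Sym2 V), IsMatchingSet G F → F.ncard = k →
      ∃ M : G.Subgraph, M.IsPerfectMatching ∧ F ⊆ M.edgeSet

/-- A bijection between the two classes of a bipartite relation that uses only related pairs. -/
def IsPerfectPairing {α β : Type*} (r : α → β → Prop) (σ : α ≃ β) : Prop :=
  ∀ a, r a (σ a)

/-- Every partial matching with `k` pairs extends to a perfect pairing. -/
def PairingsExtend {α β : Type*} (r : α → β → Prop) (k : ℕ) : Prop :=
  ∀ (S : Finset α) (f : α → β), Set.InjOn f S → (∀ a ∈ S, r a (f a)) → S.card = k →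
    ∃ σ : α ≃ β, IsPerfectPairing r σ ∧ ∀ a ∈ S, σ a = f a

/-- The bipartite graph of the relation `r` has no proper nonempty union of components. -/
def RelConnected {α β : Type*} (r : α → β → Prop) : Prop :=
  ∀ (P : Set α) (Q : Set β), (∀ a b, r a b → (a ∈ P ↔ b ∈ Q)) →
    (P = ∅ ∧ Q = ∅) ∨ (P = Set.univ ∧ Q = Set.univ)

/-- Two nonempty sets with no related pair between them miss at least `k` of `|α|` elements. -/
def HasSurplus {α β : Type*} [Fintype α] (r : α → β → Prop) (k : ℕ) : Prop :=
  ∀ (X : Finset α) (Y : Finset β), X.Nonempty → Y.Nonempty → (∀ a ∈ X, ∀ b ∈ Y, ¬ r a b) →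
    X.card + Y.card + k ≤ Fintype.card α

section Surplus

variable {α β : Type*} [Fintype α] {r : α → β → Prop} {k : ℕ}

theorem HasSurplus.mono {l : ℕ} (hs : HasSurplus r k) (hl : l ≤ k) : HasSurplus r l := by
  intro X Y hX hY h
  have := hs X Y hX hY h
  omega

open Classical in
/-- If `k`-matchings extend, then so do all smaller matchings. -/
theorem PairingsExtend.of_card_le (hE : PairingsExtend r k) (hk : k + 1 ≤ Fintype.card α)
    {σ₀ : α ≃ β} (hσ₀ : IsPerfectPairing r σ₀) (S : Finset α) (f : α → β) (hf : Set.InjOn f S)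
    (hr : ∀ a ∈ S, r a (f a)) (hS : S.card ≤ k) :
    ∃ σ : α ≃ β, IsPerfectPairing r σ ∧ ∀ a ∈ S, σ a = f a := by
  induction S using Finset.induction_on with
  | empty => exact ⟨σ₀, hσ₀, by simp⟩
  | insert a S ha ih =>
    rw [Finset.card_insert_of_notMem ha] at hS
    obtain ⟨σ, hσ, hσS⟩ := ih (hf.mono (by simp)) (fun x hx => hr x (by simp [hx])) (by omega)
    by_cases hfa : σ a = f a
    · refine ⟨σ, hσ, fun x hx => ?_⟩
      rcases Finset.mem_insert.1 hx with rfl | hx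
      · exact hfa
      · exact hσS x hx
    have ha' : σ.symm (f a) ∉ S := by
      intro h
      have h1 := hσS _ h
      rw [Equiv.apply_symm_apply] at h1
      have h2 := hf (by simp) (by simp [h]) h1
      exact ha (h2 ▸ h)
    have haa : a ≠ σ.symm (f a) := by
      intro h
      apply hfa
      conv_lhs => rw [h]
      simp
    obtain ⟨T, hST, hT, hTk⟩ := Finset.exists_subsuperset_card_eq
      (s := insert a S) (t := Finset.univ.erase (σ.symm (f a))) (n := k)
      (by
        intro x hx
        rw [Finset.mem_erase]
        refine ⟨?_, Finset.mem_univ _⟩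
        rintro rfl
        rcases Finset.mem_insert.1 hx with hx | hx
        · exact haa hx.symm
        · exact ha' hx)
      (by rw [Finset.card_insert_of_notMem ha]; exact hS)
      (by rw [Finset.card_erase_of_mem (Finset.mem_univ _), Finset.card_univ]; omega)
    have hTa : ∀ x ∈ T, σ x ≠ f a := by
      intro x hx h
      have := hT hx
      rw [← h] at this
      simp at this
    obtain ⟨τ, hτ, hτT⟩ := hE T (Function.update σ a (f a))
      (by
        intro x hx y hy hxy
        by_cases h1 : x = a <;> by_cases h2 : y = a
        · rw [h1, h2]
        · subst h1
          simp only [Function.update_self, Function.update_of_ne h2] at hxy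
          exact absurd hxy.symm (hTa y hy)
        · subst h2
          simp only [Function.update_self, Function.update_of_ne h1] at hxy
          exact absurd hxy (hTa x hx)
        · simp only [Function.update_of_ne h2, Function.update_of_ne h1] at hxy
          exact σ.injective hxy)
      (by
        intro x _
        by_cases h1 : x = a
        · subst h1
          simpa using hr x (by simp)
        · simpa [Function.update_of_ne h1] using hσ x)
      hTk
    refine ⟨τ, hτ, fun x hx => ?_⟩
    rw [hτT x (hST hx)]
    by_cases h1 : x = a
    · subst h1; simp
    · rw [Function.update_of_ne h1]
      exact hσS x ((Finset.mem_insert.1 hx).resolve_left h1)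

open Classical in
/-- A perfect pairing has exactly `|α| - |X| - |Y|` pairs avoiding both classes of an unrelated
pair `(X, Y)`. -/
theorem IsPerfectPairing.card_avoiding {σ : α ≃ β} (hσ : IsPerfectPairing r σ) {X : Finset α}
    {Y : Finset β} (hXY : ∀ a ∈ X, ∀ b ∈ Y, ¬ r a b) :
    (Finset.univ.filter fun a => a ∉ X ∧ σ a ∉ Y).card + (X.card + Y.card) = Fintype.card α := by
  have hd : Disjoint X (Y.map σ.symm.toEmbedding) := by
    rw [Finset.disjoint_left]
    intro a ha hb
    simp only [Finset.mem_map_equiv, Equiv.symm_symm] at hb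
    exact hXY a ha _ hb (hσ a)
  have h1 : (X ∪ Y.map σ.symm.toEmbedding).card = X.card + Y.card := by
    rw [Finset.card_union_of_disjoint hd, Finset.card_map]
  have h2 : (Finset.univ.filter fun a => a ∉ X ∧ σ a ∉ Y) = (X ∪ Y.map σ.symm.toEmbedding)ᶜ := by
    ext a
    simp [Finset.mem_map_equiv]
  rw [h2, ← h1, Finset.card_compl_add_card]

open Classical in
/-- In a connected bipartite relation in which all matchings of size at most `k` extend, every
unrelated pair of nonempty sets has surplus `k`. -/
theorem hasSurplus_of_forall_extend (hC : RelConnected r) :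
    ∀ k : ℕ, (∀ (S : Finset α) (f : α → β), Set.InjOn f S → (∀ a ∈ S, r a (f a)) → S.card ≤ k →
      ∃ σ : α ≃ β, IsPerfectPairing r σ ∧ ∀ a ∈ S, σ a = f a) → HasSurplus r k := by
  intro k
  induction k with
  | zero =>
    intro hE X Y _ hY hXY
    obtain ⟨b, _⟩ := hY
    by_cases hα : IsEmpty α
    · obtain rfl : X = ∅ := Finset.eq_empty_of_isEmpty X
      simp_all
    obtain ⟨a⟩ := not_isEmpty_iff.1 hα
    obtain ⟨σ, hσ, -⟩ := hE ∅ (fun _ => b) (by simp) (by simp) (by simp)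
    have := hσ.card_avoiding hXY
    omega
  | succ k ih =>
    intro hE X Y hX hY hXY
    have hS := ih fun S f h1 h2 h3 => hE S f h1 h2 (by omega)
    by_contra hcon
    have hcard : X.card + Y.card + k = Fintype.card α := by
      have := hS X Y hX hY hXY
      omega
    have hno : ∀ (S : Finset α) (f : α → β), Set.InjOn f S → (∀ a ∈ S, r a (f a)) →
        S.card = k + 1 → (∀ a ∈ S, a ∉ X ∧ f a ∉ Y) → False := by
      intro S f h1 h2 h3 h4
      obtain ⟨σ, hσ, hσS⟩ := hE S f h1 h2 (by omega)
      have h5 := hσ.card_avoiding hXY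
      have h6 : S ⊆ Finset.univ.filter fun a => a ∉ X ∧ σ a ∉ Y := by
        intro a ha
        simp only [Finset.mem_filter, Finset.mem_univ, true_and]
        rw [hσS a ha]
        exact h4 a ha
      have := Finset.card_le_card h6
      omega
    obtain ⟨b₀, hb₀⟩ := hY
    obtain ⟨x₀, hx₀⟩ := hX
    obtain ⟨σ, hσ, -⟩ := hE ∅ (fun _ => b₀) (by simp) (by simp) (by simp)
    have hQ := hσ.card_avoiding hXY
    set Q := Finset.univ.filter fun a => a ∉ X ∧ σ a ∉ Y with hQdef
    have memQ : ∀ a, a ∈ Q ↔ a ∉ X ∧ σ a ∉ Y := by simp [hQdef]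
    have hX' : ∀ a ∈ X, σ a ∉ Y := fun a ha hb => hXY a ha _ hb (hσ a)
    have hsep : ∀ w x, σ w ∈ Y → x ∈ X → ¬ r w (σ x) := by
      intro w x hw hx hwx
      have hwX : w ∉ X := fun h => hX' w h hw
      have hwQ : w ∉ Q := fun h => ((memQ w).1 h).2 hw
      refine hno (insert w Q) (Function.update σ w (σ x)) ?_ ?_ ?_ ?_
      · intro u hu v hv huv
        have hxQ : x ∉ Q := fun h => ((memQ x).1 h).1 hx
        have hxw : x ≠ w := fun h => hwX (h ▸ hx)
        simp only [Finset.coe_insert, Set.mem_insert_iff, Finset.mem_coe] at hu hv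
        simp only [Function.update_apply] at huv
        split_ifs at huv <;> have := σ.injective.eq_iff.1 huv <;> grind
      · intro u hu
        rcases Finset.mem_insert.1 hu with rfl | hu
        · simpa using hwx
        · rw [Function.update_of_ne (ne_of_mem_of_not_mem hu hwQ)]; exact hσ u
      · rw [Finset.card_insert_of_notMem hwQ]; omega
      · intro u hu
        rcases Finset.mem_insert.1 hu with rfl | hu
        · simpa using ⟨hwX, hX' x hx⟩
        · rw [Function.update_of_ne (ne_of_mem_of_not_mem hu hwQ)]; exact (memQ u).1 hu
    rcases Q.eq_empty_or_nonempty with hQ0 | ⟨w, hw⟩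
    · rcases hC X (X.image σ) (by
        intro a b hab
        have hn : ∀ c, c ∈ X ∨ σ c ∈ Y := by
          intro c
          have : c ∉ Q := by simp [hQ0]
          rw [memQ] at this
          tauto
        simp only [Finset.mem_coe, Finset.mem_image]
        constructor
        · intro ha
          refine ⟨σ.symm b, ?_, by simp⟩
          refine (hn (σ.symm b)).resolve_right ?_
          rw [Equiv.apply_symm_apply]
          exact fun hb => hXY a ha b hb hab
        · rintro ⟨x, hx, rfl⟩
          exact (hn a).resolve_right fun h => hsep a x h hx hab) with ⟨h, -⟩ | ⟨h, -⟩
      · have : x₀ ∈ (X : Set α) := hx₀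
        rw [h] at this
        exact this
      · have : σ.symm b₀ ∈ (X : Set α) := by rw [h]; trivial
        exact hX' _ this (by simpa using hb₀)
    · have hw' := (memQ w).1 hw
      obtain ⟨x, hx, hwx⟩ : ∃ x ∈ X, r w (σ x) := by
        by_contra hcon'
        push Not at hcon'
        have := hS (insert w (Y.map σ.symm.toEmbedding)) (X.map σ.toEmbedding) (by simp)
          (by simpa using ⟨x₀, hx₀⟩) (by
            intro a ha b hb
            obtain ⟨x, hx, rfl⟩ := Finset.mem_map.1 hb
            rcases Finset.mem_insert.1 ha with rfl | ha
            · exact hcon' x hx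
            · exact hsep a x (by simpa [Finset.mem_map_equiv] using ha) hx)
        rw [Finset.card_insert_of_notMem (by simpa [Finset.mem_map_equiv] using hw'.2),
          Finset.card_map, Finset.card_map] at this
        omega
      obtain ⟨v, hv, hvw⟩ : ∃ v, σ v ∈ Y ∧ r v (σ w) := by
        by_contra hcon'
        push Not at hcon'
        have := hS (Y.map σ.symm.toEmbedding) (insert (σ w) (X.map σ.toEmbedding))
          (by simpa using ⟨b₀, hb₀⟩) (by simp) (by
            intro a ha b hb
            have ha' : σ a ∈ Y := by simpa [Finset.mem_map_equiv] using ha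
            rcases Finset.mem_insert.1 hb with rfl | hb
            · exact hcon' a ha'
            · obtain ⟨x, hx, rfl⟩ := Finset.mem_map.1 hb
              exact hsep a x ha' hx)
        rw [Finset.card_insert_of_notMem (by simpa [Finset.mem_map_equiv] using hw'.1),
          Finset.card_map, Finset.card_map] at this
        omega
      have hvX : v ∉ X := fun h => hX' v h hv
      have hvQ : v ∉ Q := fun h => ((memQ v).1 h).2 hv
      have hvw' : v ≠ w := fun h => hvQ (h ▸ hw)
      have hxQ : x ∉ Q := fun h => ((memQ x).1 h).1 hx
      have hxv : x ≠ v := fun h => hvX (h ▸ hx)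
      refine hno (insert v Q) (fun a => if a = v then σ w else if a = w then σ x else σ a)
        ?_ ?_ ?_ ?_
      · intro u hu u' hu' huu
        simp only [Finset.coe_insert, Set.mem_insert_iff, Finset.mem_coe] at hu hu'
        dsimp only at huu
        split_ifs at huu <;> have := σ.injective.eq_iff.1 huu <;> grind
      · intro u hu
        split_ifs with h1 h2
        · rw [h1]; exact hvw
        · rw [h2]; exact hwx
        · exact hσ u
      · rw [Finset.card_insert_of_notMem hvQ]; omega
      · intro u hu
        split_ifs with h1 h2
        · rw [h1]; exact ⟨hvX, hw'.2⟩
        · rw [h2]; exact ⟨hw'.1, hX' x hx⟩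
        · exact (memQ u).1 ((Finset.mem_insert.1 hu).resolve_left h1)

/-- A connected bipartite relation whose `k`-matchings extend has surplus `k`. -/
theorem PairingsExtend.hasSurplus (hE : PairingsExtend r k) (hC : RelConnected r)
    (hk : k + 1 ≤ Fintype.card α) {σ₀ : α ≃ β} (hσ₀ : IsPerfectPairing r σ₀) : HasSurplus r k :=
  hasSurplus_of_forall_extend hC k (hE.of_card_le hk hσ₀)

open Classical in
/-- Positive surplus forces connectedness. -/
theorem HasSurplus.relConnected [Fintype β] (hs : HasSurplus r k) (hk : 1 ≤ k)
    (hcard : Fintype.card α = Fintype.card β) : RelConnected r := by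
  intro P Q hPQ
  have h1 := hs P.toFinset (Q.toFinset)ᶜ
  have h2 := hs (P.toFinset)ᶜ Q.toFinset
  simp only [Finset.mem_compl, Set.mem_toFinset, ← Finset.card_pos,
    Finset.card_compl] at h1 h2
  have hP := Finset.card_le_univ P.toFinset
  have hQ := Finset.card_le_univ Q.toFinset
  have e1 := fun h h' => h1 h h' (fun a ha b hb hab => hb ((hPQ a b hab).1 ha))
  have e2 := fun h h' => h2 h h' (fun a ha b hb hab => ha ((hPQ a b hab).2 hb))
  by_cases hp : P.toFinset.card = 0
  · by_cases hq : Q.toFinset.card = 0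
    · left
      rw [Finset.card_eq_zero, Set.toFinset_eq_empty] at hp hq
      exact ⟨hp, hq⟩
    · omega
  · have hpe : P.toFinset.card = Fintype.card α := by omega
    have hqe : Q.toFinset.card = Fintype.card β := by omega
    right
    rw [Finset.card_eq_iff_eq_univ, Set.toFinset_eq_univ] at hpe hqe
    exact ⟨hpe, hqe⟩

open Classical in
/-- Surplus `k` lets every `k`-matching extend. -/
theorem HasSurplus.pairingsExtend [Fintype β] (hs : HasSurplus r k)
    (hcard : Fintype.card α = Fintype.card β) : PairingsExtend r k := by
  intro S f hf hr hS
  obtain ⟨g, hg, hgr⟩ := (Finset.all_card_le_biUnion_card_iff_exists_injective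
    (fun a : {a // a ∉ S} => Finset.univ.filter fun b => r a b ∧ b ∉ S.image f)).1 (by
      intro U
      rcases U.eq_empty_or_nonempty with rfl | hU
      · simp
      set N : Finset β := Finset.univ.filter fun b => ∃ a ∈ U, r a b with hN
      have h1 : N \ S.image f ⊆ U.biUnion
          fun a => Finset.univ.filter fun b => r a b ∧ b ∉ S.image f := by
        intro b hb
        simp only [hN, Finset.mem_sdiff, Finset.mem_filter, Finset.mem_univ, true_and] at hb
        obtain ⟨⟨a, ha, hab⟩, hb⟩ := hb
        exact Finset.mem_biUnion.2 ⟨a, ha, by simpa [hab] using hb⟩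
      have h2 := Finset.card_le_card h1
      have h3 := Finset.le_card_sdiff (S.image f) N
      have h4 : (S.image f).card = k := by rw [Finset.card_image_of_injOn hf, hS]
      have h5 : U.card + S.card ≤ Fintype.card α := by
        have := Finset.card_le_univ U
        rw [Fintype.card_subtype_compl, Fintype.card_coe] at this
        have := Finset.card_le_univ S
        omega
      have h6 : N.card + Nᶜ.card = Fintype.card β := Finset.card_add_card_compl N
      rcases (Nᶜ).eq_empty_or_nonempty with h0 | h0
      · rw [h0, Finset.card_empty] at h6
        omega
      · have := hs (U.map (Function.Embedding.subtype _)) Nᶜ (by simpa using hU) h0 (by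
          intro a ha b hb hab
          obtain ⟨u, hu, rfl⟩ := Finset.mem_map.1 ha
          rw [Finset.mem_compl, hN] at hb
          exact hb (Finset.mem_filter.2 ⟨Finset.mem_univ b, u, hu, hab⟩))
        rw [Finset.card_map] at this
        omega)
  simp only [Finset.mem_filter, Finset.mem_univ, true_and, Finset.mem_image, not_exists,
    not_and] at hgr
  let h : α → β := fun a => if ha : a ∈ S then f a else g ⟨a, ha⟩
  have hinj : Function.Injective h := by
    intro x y hxy
    simp only [h] at hxy
    split_ifs at hxy with hx hy hy
    · exact hf hx hy hxy
    · exact absurd hxy ((hgr ⟨y, hy⟩).2 x hx)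
    · exact absurd hxy.symm ((hgr ⟨x, hx⟩).2 y hy)
    · simpa using hg hxy
  refine ⟨Equiv.ofBijective h ((Fintype.bijective_iff_injective_and_card h).2 ⟨hinj, hcard⟩),
    fun a => ?_, fun a ha => by simp [h, ha]⟩
  simp only [Equiv.ofBijective_apply, h]
  split_ifs with ha
  · exact hr a ha
  · exact (hgr ⟨a, ha⟩).1

end Surplus

section Counting

variable {α β : Type*} {r : α → β → Prop} {k : ℕ}

/-- `(X, Y)` witnesses that the pair `(a, b)` cannot be removed without destroying surplus `k`. -/
structure IsCritical [Fintype α] (r : α → β → Prop) (k : ℕ) (a : α) (b : β) (X : Finset α)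
    (Y : Finset β) : Prop where
  left_mem : a ∈ X
  right_mem : b ∈ Y
  card_add : X.card + Y.card + k = Fintype.card α + 1
  unique : ∀ a' ∈ X, ∀ b' ∈ Y, r a' b' → a' = a ∧ b' = b

theorem HasSurplus.flip [Fintype α] [Fintype β] (hs : HasSurplus r k)
    (hcard : Fintype.card α = Fintype.card β) : HasSurplus (flip r) k := by
  intro X Y hX hY h
  have := hs Y X hY hX fun a ha b hb => h b hb a ha
  omega

theorem IsCritical.flip [Fintype α] [Fintype β] {a : α} {b : β} {X : Finset α} {Y : Finset β}
    (h : IsCritical r k a b X Y) (hcard : Fintype.card α = Fintype.card β) :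
    IsCritical (flip r) k b a Y X :=
  ⟨h.right_mem, h.left_mem, by have := h.card_add; omega,
    fun b' hb' a' ha' h' => (h.unique a' ha' b' hb' h').symm⟩

open Classical in
/-- If removing the pair `(a, b)` destroys surplus `k`, there is a critical witness. -/
theorem HasSurplus.exists_isCritical [Fintype α] (hs : HasSurplus r k)
    (hk : k + 1 ≤ Fintype.card α) {a : α} {b : β}
    (h : ¬ HasSurplus (fun x y => r x y ∧ ¬ (x = a ∧ y = b)) k) :
    ∃ X Y, IsCritical r k a b X Y := by
  unfold HasSurplus at h
  push Not at h
  obtain ⟨X, Y, hX, hY, hXY, hlt⟩ := h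
  have hu : ∀ a' ∈ X, ∀ b' ∈ Y, r a' b' → a' = a ∧ b' = b := fun a' ha' b' hb' hr => by
    have := hXY a' ha' b' hb' hr
    tauto
  have hab : a ∈ X ∧ b ∈ Y := by
    by_contra hcon
    have := hs X Y hX hY fun a' ha' b' hb' hr => by
      obtain ⟨rfl, rfl⟩ := hu a' ha' b' hb' hr
      exact hcon ⟨ha', hb'⟩
    omega
  refine ⟨X, Y, hab.1, hab.2, ?_, hu⟩
  have hXc := Finset.card_erase_of_mem hab.1
  have hYc := Finset.card_erase_of_mem hab.2
  have hX0 := hX.card_pos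
  have hY0 := hY.card_pos
  rcases (X.erase a).eq_empty_or_nonempty with h1 | h1
  · rcases (Y.erase b).eq_empty_or_nonempty with h2 | h2
    · rw [h1, Finset.card_empty] at hXc
      rw [h2, Finset.card_empty] at hYc
      omega
    · have := hs X (Y.erase b) hX h2 fun a' ha' b' hb' hr =>
        Finset.ne_of_mem_erase hb' (hu a' ha' b' (Finset.mem_of_mem_erase hb') hr).2
      omega
  · have := hs (X.erase a) Y h1 hY fun a' ha' b' hb' hr =>
      Finset.ne_of_mem_erase ha' (hu a' (Finset.mem_of_mem_erase ha') b' hb' hr).1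
    omega

open Classical in
/-- Surplus `k` forces degree at least `k + 1`. -/
theorem HasSurplus.le_degree [Fintype α] [Fintype β] (hs : HasSurplus r k)
    (hcard : Fintype.card α = Fintype.card β) (hk : k + 1 ≤ Fintype.card α) (a : α) :
    k + 1 ≤ (Finset.univ.filter fun b => r a b).card := by
  have h1 := Finset.card_add_card_compl (Finset.univ.filter fun b => r a b)
  rcases ((Finset.univ.filter fun b => r a b)ᶜ).eq_empty_or_nonempty with h | h
  · rw [h, Finset.card_empty] at h1
    omega
  · have := hs {a} _ (by simp) h (by simp)
    rw [Finset.card_singleton] at this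
    omega

open Classical in
/-- Critical witnesses of two pairs that share a vertex of degree at least `k + 2` have small
second components. -/
theorem IsCritical.card_add_card_le [Fintype α] [Fintype β] (hs : HasSurplus r k)
    (hcard : Fintype.card α = Fintype.card β) {a : α}
    (ha : k + 1 < (Finset.univ.filter fun b => r a b).card) {b b' : β} (hbb : b ≠ b')
    (hab : r a b) (hab' : r a b') {X X' : Finset α} {Y Y' : Finset β}
    (h : IsCritical r k a b X Y) (h' : IsCritical r k a b' X' Y') :
    Y.card + Y'.card + k ≤ Fintype.card α := by
  have hXi := Finset.card_union_add_card_inter X X'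
  have hYi := Finset.card_union_add_card_inter Y Y'
  have hc := h.card_add
  have hc' := h'.card_add
  have haI : a ∈ X ∩ X' := Finset.mem_inter.2 ⟨h.left_mem, h'.left_mem⟩
  have haI0 : 0 < (X ∩ X').card := Finset.card_pos.2 ⟨a, haI⟩
  have hmain : Fintype.card α < (X ∪ X').card + (Y ∩ Y').card + k := by
    by_contra hcon
    have hIc := Finset.card_erase_of_mem haI
    rcases ((X ∩ X').erase a).eq_empty_or_nonempty with h0 | h0
    · rw [h0, Finset.card_empty] at hIc
      have hsub : (Finset.univ.filter fun b => r a b) ⊆ insert b (insert b' (Y ∪ Y')ᶜ) := by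
        intro y hy
        simp only [Finset.mem_filter, Finset.mem_univ, true_and] at hy
        simp only [Finset.mem_insert, Finset.mem_compl, Finset.mem_union]
        by_contra hy'
        push Not at hy'
        rcases hy'.2.2 with hyY | hyY
        · exact hy'.1 (h.unique a h.left_mem y hyY hy).2
        · exact hy'.2.1 (h'.unique a h'.left_mem y hyY hy).2
      have h1 := Finset.card_le_card hsub
      have h2 := Finset.card_insert_le b (insert b' (Y ∪ Y')ᶜ)
      have h3 := Finset.card_insert_le b' (Y ∪ Y')ᶜ
      have h4 := Finset.card_add_card_compl (Y ∪ Y')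
      omega
    · have := hs ((X ∩ X').erase a) (Y ∪ Y') h0
        ⟨b, Finset.mem_union_left _ h.right_mem⟩ (by
          intro x hx y hy hxy
          rw [Finset.mem_erase, Finset.mem_inter] at hx
          rcases Finset.mem_union.1 hy with hy | hy
          · exact hx.1 (h.unique x hx.2.1 y hy hxy).1
          · exact hx.1 (h'.unique x hx.2.2 y hy hxy).1)
      omega
  have hY0 : Y ∩ Y' = ∅ := by
    by_contra hne
    have := hs (X ∪ X') (Y ∩ Y') ⟨a, Finset.mem_union_left _ h.left_mem⟩
      (Finset.nonempty_iff_ne_empty.2 hne) (by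
        intro x hx y hy hxy
        rw [Finset.mem_inter] at hy
        rcases Finset.mem_union.1 hx with hx | hx
        · obtain ⟨rfl, rfl⟩ := h.unique x hx y hy.1 hxy
          exact hbb (h'.unique x h'.left_mem y hy.2 hab).2
        · obtain ⟨rfl, rfl⟩ := h'.unique x hx y hy.2 hxy
          exact hbb (h.unique x h.left_mem y hy.1 hab').2.symm)
    omega
  rw [hY0, Finset.card_empty] at hmain
  omega

/-- A set of pairs carrying an integer weight such that any two pairs with the same first entry
have positive total weight, and any two with the same second entry have negative total weight,
has fewer elements than there are entries available (it is the edge set of a forest). -/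
theorem card_lt_of_weight {E : Finset (α × β)} {A : Finset α} {B : Finset β} (g : α × β → ℤ)
    (hA : ∀ e ∈ E, e.1 ∈ A) (hB : ∀ e ∈ E, e.2 ∈ B)
    (h1 : ∀ e ∈ E, ∀ f ∈ E, e ≠ f → e.1 = f.1 → 0 < g e + g f)
    (h2 : ∀ e ∈ E, ∀ f ∈ E, e ≠ f → e.2 = f.2 → g e + g f < 0)
    (hne : 0 < A.card + B.card) : E.card < A.card + B.card := by
  classical
  rcases E.eq_empty_or_nonempty with rfl | hE
  · simpa using hne
  let φ : α × β → α ⊕ β := fun e => if g e ≤ 0 then Sum.inl e.1 else Sum.inr e.2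
  have hφ : Set.InjOn φ E := by
    intro e he f hf hef
    by_contra hne'
    simp only [φ] at hef
    split_ifs at hef with h3 h4 h4
    · have := h1 e he f hf hne' (Sum.inl_injective hef)
      omega
    · have := h2 e he f hf hne' (Sum.inr_injective hef)
      omega
  obtain ⟨e, he, hmin⟩ := E.exists_min_image (fun e => |g e|) hE
  have hmiss : ∃ v ∈ A.disjSum B, ∀ f ∈ E, φ f ≠ v := by
    by_cases h3 : g e ≤ 0
    · refine ⟨Sum.inr e.2, Finset.inr_mem_disjSum.2 (hB e he), fun f hf hfv => ?_⟩
      simp only [φ] at hfv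
      split_ifs at hfv with h4
      have := h2 e he f hf (by rintro rfl; exact h4 h3) (Sum.inr_injective hfv).symm
      have := hmin f hf
      rw [abs_of_nonpos h3, abs_of_pos (not_le.1 h4)] at this
      omega
    · refine ⟨Sum.inl e.1, Finset.inl_mem_disjSum.2 (hA e he), fun f hf hfv => ?_⟩
      simp only [φ] at hfv
      split_ifs at hfv with h4
      have := h1 e he f hf (by rintro rfl; exact h3 h4) (Sum.inl_injective hfv).symm
      have := hmin f hf
      rw [abs_of_nonpos h4, abs_of_pos (not_le.1 h3)] at this
      omega
  obtain ⟨v, hv, hvE⟩ := hmiss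
  have hsub : E.image φ ⊆ (A.disjSum B).erase v := by
    intro w hw
    obtain ⟨f, hf, rfl⟩ := Finset.mem_image.1 hw
    refine Finset.mem_erase.2 ⟨hvE f hf, ?_⟩
    simp only [φ]
    split_ifs
    · exact Finset.inl_mem_disjSum.2 (hA f hf)
    · exact Finset.inr_mem_disjSum.2 (hB f hf)
  have h5 := Finset.card_le_card hsub
  rw [Finset.card_image_of_injOn hφ, Finset.card_erase_of_mem hv, Finset.card_disjSum] at h5
  omega

open Classical in
/-- The number of pairs of a relation with surplus `k` in which every pair is critical. -/
theorem HasSurplus.card_pairs_lt [Fintype α] [Fintype β] (hs : HasSurplus r k)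
    (hcard : Fintype.card α = Fintype.card β) (hk : 1 ≤ k) (hkc : k + 1 ≤ Fintype.card α)
    (hcrit : ∀ a b, r a b → ∃ X Y, IsCritical r k a b X Y) :
    (Finset.univ.filter fun e : α × β => r e.1 e.2).card + 1 ≤
      k * ((Finset.univ.filter fun a => (Finset.univ.filter fun b => r a b).card = k + 1).card +
        (Finset.univ.filter fun b => (Finset.univ.filter fun a => r a b).card = k + 1).card) +
      (Fintype.card α + Fintype.card β) := by
  have hs' := hs.flip hcard
  set dA : α → ℕ := fun a => (Finset.univ.filter fun b => r a b).card with hdA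
  set dB : β → ℕ := fun b => (Finset.univ.filter fun a => r a b).card with hdB
  have hdA' : ∀ a, k + 1 ≤ dA a := hs.le_degree hcard hkc
  have hdB' : ∀ b, k + 1 ≤ dB b := hs'.le_degree hcard.symm (by omega)
  set E : Finset (α × β) := Finset.univ.filter fun e : α × β => r e.1 e.2 with hE
  set LA := Finset.univ.filter fun a => dA a = k + 1 with hLA
  set LB := Finset.univ.filter fun b => dB b = k + 1 with hLB
  choose! X Y hXY using hcrit
  have hcA := Finset.card_add_card_compl LA
  have hcB := Finset.card_add_card_compl LB
  have hfibA : ∀ a, (E.filter fun e => e.1 = a).card = dA a := by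
    intro a
    refine Finset.card_bij' (fun e _ => e.2) (fun b _ => (a, b)) ?_ ?_ ?_ ?_ <;> grind
  have hfibB : ∀ b, (E.filter fun e => e.2 = b).card = dB b := by
    intro b
    refine Finset.card_bij' (fun e _ => e.1) (fun a _ => (a, b)) ?_ ?_ ?_ ?_ <;> grind
  have hEA : (E.filter fun e => e.1 ∈ LA).card = LA.card * (k + 1) := by
    rw [Finset.card_eq_sum_card_fiberwise (f := Prod.fst) (t := LA) (by intro e he; simp_all),
      Finset.sum_const_nat]
    intro a ha
    rw [Finset.filter_filter, ← (Finset.mem_filter.1 ha).2, ← hfibA a]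
    congr 1
    grind
  have hEB : (E.filter fun e => e.2 ∈ LB).card = LB.card * (k + 1) := by
    rw [Finset.card_eq_sum_card_fiberwise (f := Prod.snd) (t := LB) (by intro e he; simp_all),
      Finset.sum_const_nat]
    intro b hb
    rw [Finset.filter_filter, ← (Finset.mem_filter.1 hb).2, ← hfibB b]
    congr 1
    grind
  by_cases hpos : 0 < LAᶜ.card + LBᶜ.card
  · have hH := card_lt_of_weight (E := E.filter fun e => e.1 ∉ LA ∧ e.2 ∉ LB) (A := LAᶜ)
      (B := LBᶜ) (fun e => ((X e.1 e.2).card : ℤ) - (Y e.1 e.2).card)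
      (fun e he => Finset.mem_compl.2 (Finset.mem_filter.1 he).2.1)
      (fun e he => Finset.mem_compl.2 (Finset.mem_filter.1 he).2.2)
      (by
        rintro ⟨a, b⟩ he ⟨a', b'⟩ hf hne (rfl : a = a')
        simp only [hE, hLA, Finset.mem_filter, Finset.mem_univ, true_and] at he hf
        have h1 := hdA' a
        have h2 := hXY a b he.1
        have h3 := hXY a b' hf.1
        have h4 := IsCritical.card_add_card_le hs hcard (a := a)
          (show k + 1 < dA a by omega) (by simpa using hne) he.1 hf.1 h2 h3
        have h5 := h2.card_add
        have h6 := h3.card_add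
        dsimp only
        omega)
      (by
        rintro ⟨a, b⟩ he ⟨a', b'⟩ hf hne (rfl : b = b')
        simp only [hE, hLB, Finset.mem_filter, Finset.mem_univ, true_and] at he hf
        have h1 := hdB' b
        have h2 := hXY a b he.1
        have h3 := hXY a' b hf.1
        have h4 := IsCritical.card_add_card_le hs' hcard.symm (a := b)
          (show k + 1 < dB b by omega) (by simpa using hne) he.1 hf.1 (h2.flip hcard)
          (h3.flip hcard)
        have h5 := h2.card_add
        have h6 := h3.card_add
        dsimp only
        omega) hpos
    have hcov : E ⊆ (E.filter fun e => e.1 ∉ LA ∧ e.2 ∉ LB) ∪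
        ((E.filter fun e => e.1 ∈ LA) ∪ E.filter fun e => e.2 ∈ LB) := by
      intro e he
      simp only [Finset.mem_union, Finset.mem_filter, he, true_and]
      tauto
    have h1 := Finset.card_le_card hcov
    have h2 := Finset.card_union_le (E.filter fun e => e.1 ∉ LA ∧ e.2 ∉ LB)
      ((E.filter fun e => e.1 ∈ LA) ∪ E.filter fun e => e.2 ∈ LB)
    have h3 := Finset.card_union_le (E.filter fun e => e.1 ∈ LA) (E.filter fun e => e.2 ∈ LB)
    nlinarith
  · have hLA1 : LA.card = Fintype.card α := by omega
    have hLB1 : LB.card = Fintype.card β := by omega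
    have hEe : (E.filter fun e => e.1 ∈ LA) = E := by
      rw [Finset.card_eq_iff_eq_univ] at hLA1
      simp [hLA1]
    rw [hEe, hLA1] at hEA
    rw [hEA, hLA1, hLB1]
    nlinarith

end Counting

section Translation

variable {V : Type*} {G : SimpleGraph V} {k : ℕ} {p : V → Prop}

/-- The adjacency relation of `G` between the vertices satisfying `p` and the others. -/
def crossAdj (G : SimpleGraph V) (p : V → Prop) (a : {v // p v}) (b : {v // ¬ p v}) : Prop :=
  G.Adj a b

theorem mk_injective_cross (f : {v // p v} → {v // ¬ p v}) :
    Function.Injective fun a : {v // p v} => s((a : V), (f a : V)) := by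
  intro a a' h
  rcases Sym2.eq_iff.1 h with ⟨h1, -⟩ | ⟨h1, -⟩
  · exact Subtype.ext h1
  · exact absurd (h1 ▸ a.2) (f a').2

theorem isMatchingSet_image {S : Set {v // p v}} {f : {v // p v} → {v // ¬ p v}}
    (hf : Set.InjOn f S) (hr : ∀ a ∈ S, crossAdj G p a (f a)) :
    IsMatchingSet G ((fun a : {v // p v} => s((a : V), (f a : V))) '' S) := by
  refine ⟨?_, ?_⟩
  · rintro _ ⟨a, ha, rfl⟩
    exact hr a ha
  · rintro _ ⟨a, ha, rfl⟩ _ ⟨a', ha', rfl⟩ hne u hu hu'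
    simp only [Sym2.mem_iff] at hu hu'
    apply hne
    have haa : a = a' := by
      rcases hu with rfl | rfl <;> rcases hu' with h | h
      · exact Subtype.ext h
      · exact absurd (h ▸ a.2) (f a').2
      · exact absurd (h ▸ a'.2) (f a).2
      · exact hf ha ha' (Subtype.ext h)
    rw [haa]

/-- A perfect matching of a bipartite graph gives a perfect pairing of the two classes. -/
theorem exists_isPerfectPairing (hp : ∀ u v, G.Adj u v → (p u ↔ ¬ p v)) {M : G.Subgraph}
    (hM : M.IsPerfectMatching) :
    ∃ σ : {v // p v} ≃ {v // ¬ p v}, IsPerfectPairing (crossAdj G p) σ ∧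
      ∀ a b, M.Adj a b → ∀ h : p a, (σ ⟨a, h⟩ : V) = b := by
  rw [Subgraph.isPerfectMatching_iff] at hM
  choose m hm hm' using hM
  have hmm : ∀ v, m (m v) = v := fun v => (hm' (m v) v (hm v).symm).symm
  refine ⟨⟨fun a => ⟨m a, (hp _ _ (hm a).adj_sub).1 a.2⟩,
    fun b => ⟨m b, (hp _ _ (hm b).adj_sub.symm).2 b.2⟩, fun a => Subtype.ext (hmm a),
    fun b => Subtype.ext (hmm b)⟩, fun a => (hm a).adj_sub, fun a b hab _ => (hm' a b hab).symm⟩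

/-- A perfect pairing of the two classes is a perfect matching. -/
theorem IsPerfectPairing.exists_isPerfectMatching {σ : {v // p v} ≃ {v // ¬ p v}}
    (hσ : IsPerfectPairing (crossAdj G p) σ) :
    ∃ M : G.Subgraph, M.IsPerfectMatching ∧ ∀ a : {v // p v}, M.Adj a (σ a) := by
  let M : G.Subgraph :=
    { verts := Set.univ
      Adj := fun u v => ∃ a : {v // p v}, (u = a ∧ v = σ a) ∨ (v = a ∧ u = σ a)
      adj_sub := by
        rintro u v ⟨a, ⟨rfl, rfl⟩ | ⟨rfl, rfl⟩⟩
        · exact hσ a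
        · exact (hσ a).symm
      edge_vert := fun _ => trivial
      symm := ⟨by
        rintro u v ⟨a, h⟩
        exact ⟨a, h.symm⟩⟩ }
  refine ⟨M, Subgraph.isPerfectMatching_iff.2 fun v => ?_, fun a => ⟨a, Or.inl ⟨rfl, rfl⟩⟩⟩
  by_cases hv : p v
  · refine ⟨σ ⟨v, hv⟩, ⟨⟨v, hv⟩, Or.inl ⟨rfl, rfl⟩⟩, ?_⟩
    rintro w ⟨a, ⟨rfl, rfl⟩ | ⟨rfl, rfl⟩⟩
    · rfl
    · exact absurd hv (σ a).2
  · refine ⟨σ.symm ⟨v, hv⟩, ⟨σ.symm ⟨v, hv⟩, Or.inr ⟨rfl, by simp⟩⟩, ?_⟩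
    rintro w ⟨a, ⟨rfl, rfl⟩ | ⟨rfl, rfl⟩⟩
    · exact absurd a.2 hv
    · simp

theorem relConnected_of_connected (hp : ∀ u v, G.Adj u v → (p u ↔ ¬ p v)) (hG : G.Connected) :
    RelConnected (crossAdj G p) := by
  intro P Q hPQ
  let C : V → Prop := fun v => (∃ h : p v, ⟨v, h⟩ ∈ P) ∨ ∃ h : ¬ p v, ⟨v, h⟩ ∈ Q
  have hC : ∀ u v, G.Adj u v → C u → C v := by
    rintro u v huv (⟨h, hu⟩ | ⟨h, hu⟩)
    · have hv := (hp u v huv).1 h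
      exact Or.inr ⟨hv, (hPQ ⟨u, h⟩ ⟨v, hv⟩ huv).1 hu⟩
    · have hv := (hp v u huv.symm).2 h
      exact Or.inl ⟨hv, (hPQ ⟨v, hv⟩ ⟨u, h⟩ huv.symm).2 hu⟩
  have hC' : ∀ u v, C u → C v := fun u v hu => by
    obtain ⟨w⟩ := hG.preconnected u v
    induction w with
    | nil => exact hu
    | cons h _ ih => exact ih (hC _ _ h hu)
  by_cases hex : ∃ u, C u
  · obtain ⟨u, hu⟩ := hex
    right
    refine ⟨Set.eq_univ_of_forall fun a => ?_, Set.eq_univ_of_forall fun b => ?_⟩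
    · rcases hC' u a hu with ⟨_, h⟩ | ⟨h, _⟩
      · exact h
      · exact absurd a.2 h
    · rcases hC' u b hu with ⟨h, _⟩ | ⟨_, h⟩
      · exact absurd h b.2
      · exact h
  · left
    refine ⟨Set.eq_empty_of_forall_notMem fun a ha => hex ⟨a, Or.inl ⟨a.2, ha⟩⟩,
      Set.eq_empty_of_forall_notMem fun b hb => hex ⟨b, Or.inr ⟨b.2, hb⟩⟩⟩

theorem connected_of_relConnected [Nonempty V] (hC : RelConnected (crossAdj G p)) :
    G.Connected := by
  refine ⟨fun u v => ?_⟩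
  have h := hC {a | G.Reachable u a} {b | G.Reachable u b} fun a b hab =>
    ⟨fun h => h.trans (Adj.reachable hab), fun h => h.trans (Adj.reachable hab).symm⟩
  simp only [Set.eq_empty_iff_forall_notMem, Set.eq_univ_iff_forall, Set.mem_ofPred_eq] at h
  rcases h with ⟨h1, h2⟩ | ⟨h1, h2⟩
  · by_cases hu : p u
    · exact absurd (Reachable.refl u) (h1 ⟨u, hu⟩)
    · exact absurd (Reachable.refl u) (h2 ⟨u, hu⟩)
  · by_cases hv : p v
    · exact h1 ⟨v, hv⟩
    · exact h2 ⟨v, hv⟩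

theorem KExtendable.pairingsExtend [Fintype V] (hp : ∀ u v, G.Adj u v → (p u ↔ ¬ p v))
    (h : KExtendable G k) : PairingsExtend (crossAdj G p) k := by
  intro S f hf hr hS
  obtain ⟨M, hM, hFM⟩ := h.2.2.2 _ (isMatchingSet_image hf hr)
    (by rw [Set.ncard_image_of_injective _ (mk_injective_cross f), Set.ncard_coe_finset, hS])
  obtain ⟨σ, hσ, hσM⟩ := exists_isPerfectPairing hp hM
  refine ⟨σ, hσ, fun a ha => Subtype.ext (hσM a (f a) ?_ a.2)⟩
  exact hFM ⟨a, ha, rfl⟩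

theorem KExtendable.of_pairingsExtend [Fintype V] [Fintype {v // p v}]
    (hp : ∀ u v, G.Adj u v → (p u ↔ ¬ p v))
    (hk : k ≤ Fintype.card {v // p v}) (hV : 2 * k + 2 ≤ Fintype.card V)
    (hC : RelConnected (crossAdj G p)) (hE : PairingsExtend (crossAdj G p) k)
    {σ : {v // p v} ≃ {v // ¬ p v}} (hσ : IsPerfectPairing (crossAdj G p) σ) :
    KExtendable G k := by
  have : Nonempty V := Fintype.card_pos_iff.1 (by omega)
  refine ⟨connected_of_relConnected hC, hV, ?_, ?_⟩
  · obtain ⟨S, -, hS⟩ := Finset.exists_subset_card_eq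
      (s := (Finset.univ : Finset {v // p v})) (n := k) (by simpa using hk)
    exact ⟨_, isMatchingSet_image (S := S) σ.injective.injOn fun a _ => hσ a, by
      rw [Set.ncard_image_of_injective _ (mk_injective_cross σ), Set.ncard_coe_finset, hS]⟩
  · intro F hF hFk
    classical
    let f : {v // p v} → {v // ¬ p v} := fun a =>
      if h : ∃ b : {v // ¬ p v}, s((a : V), (b : V)) ∈ F then h.choose else σ a
    let S : Finset {v // p v} :=
      Finset.univ.filter fun a => ∃ b : {v // ¬ p v}, s((a : V), (b : V)) ∈ F
    have hfS : ∀ a : {v // p v}, a ∈ S → s((a : V), (f a : V)) ∈ F := by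
      intro a ha
      have h := (Finset.mem_filter.1 ha).2
      simp only [f, dif_pos h]
      exact h.choose_spec
    have hFS : F = (fun a : {v // p v} => s((a : V), (f a : V))) '' (S : Set {v // p v}) := by
      apply Set.Subset.antisymm
      · intro e he
        obtain ⟨a, b, hab, ha, hb⟩ : ∃ a b, e = s(a, b) ∧ p a ∧ ¬ p b := by
          induction e using Sym2.ind with
          | _ u v =>
            have huv := hp u v (hF.1 he)
            by_cases hu : p u
            · exact ⟨u, v, rfl, hu, huv.1 hu⟩
            · exact ⟨v, u, Sym2.eq_swap, by tauto, hu⟩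
        subst hab
        have haS : (⟨a, ha⟩ : {v // p v}) ∈ S :=
          Finset.mem_filter.2 ⟨Finset.mem_univ _, ⟨b, hb⟩, he⟩
        refine ⟨⟨a, ha⟩, haS, ?_⟩
        by_contra hne
        exact hF.2 _ (hfS _ haS) _ he hne a (by simp) (by simp)
      · rintro _ ⟨a, ha, rfl⟩
        exact hfS a ha
    have hf : Set.InjOn f S := by
      intro a ha a' ha' haa
      by_contra hne
      exact hF.2 _ (hfS a ha) _ (hfS a' ha') (fun h => hne (mk_injective_cross f h)) (f a)
        (by simp) (by simp [haa])
    obtain ⟨τ, hτ, hτS⟩ := hE S f hf (fun a ha => hF.1 (hfS a ha)) (by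
      rw [← hFk, hFS, Set.ncard_image_of_injective _ (mk_injective_cross f),
        Set.ncard_coe_finset])
    obtain ⟨M, hM, hMτ⟩ := hτ.exists_isPerfectMatching
    refine ⟨M, hM, ?_⟩
    rw [hFS]
    rintro _ ⟨a, ha, rfl⟩
    have := hMτ a
    rw [hτS a ha] at this
    exact this

open Classical in
theorem ncard_edgeSet_eq [Fintype {v // p v}] [Fintype {v // ¬ p v}]
    (hp : ∀ u v, G.Adj u v → (p u ↔ ¬ p v)) :
    G.edgeSet.ncard = (Finset.univ.filter
      fun e : {v // p v} × {v // ¬ p v} => crossAdj G p e.1 e.2).card := by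
  rw [← Set.ncard_coe_finset,
    ← Set.InjOn.ncard_image (f := fun e : {v // p v} × {v // ¬ p v} => s((e.1 : V), (e.2 : V)))]
  · congr 1
    ext e
    induction e using Sym2.ind with
    | _ u v =>
      simp only [mem_edgeSet, Set.mem_image, Finset.mem_coe, Finset.mem_filter, Finset.mem_univ,
        true_and]
      constructor
      · intro huv
        by_cases hu : p u
        · exact ⟨(⟨u, hu⟩, ⟨v, (hp u v huv).1 hu⟩), huv, rfl⟩
        · exact ⟨(⟨v, (hp v u huv.symm).2 hu⟩, ⟨u, hu⟩), huv.symm, Sym2.eq_swap⟩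
      · rintro ⟨⟨a, b⟩, hab, he⟩
        rw [← mem_edgeSet, ← he]
        exact hab
  · rintro ⟨a, b⟩ - ⟨a', b'⟩ - he
    rcases Sym2.eq_iff.1 he with ⟨h1, h2⟩ | ⟨h1, -⟩
    · exact Prod.ext (Subtype.ext h1) (Subtype.ext h2)
    · exact absurd (h1 ▸ a.2) b'.2

open Classical in
theorem degN_left [Fintype {v // ¬ p v}] (hp : ∀ u v, G.Adj u v → (p u ↔ ¬ p v))
    (a : {v // p v}) :
    degN G a = (Finset.univ.filter fun b => crossAdj G p a b).card := by
  rw [degN, ← Set.ncard_coe_finset, ← Set.ncard_image_of_injective _ Subtype.val_injective]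
  congr 1
  ext v
  simp only [mem_neighborSet, Finset.coe_filter, Finset.mem_univ, true_and, Set.mem_image,
    Set.mem_ofPred_eq]
  exact ⟨fun h => ⟨⟨v, (hp _ _ h).1 a.2⟩, h, rfl⟩, by rintro ⟨b, h, rfl⟩; exact h⟩

open Classical in
theorem degN_right [Fintype {v // p v}] (hp : ∀ u v, G.Adj u v → (p u ↔ ¬ p v))
    (b : {v // ¬ p v}) :
    degN G b = (Finset.univ.filter fun a => crossAdj G p a b).card := by
  rw [degN, ← Set.ncard_coe_finset, ← Set.ncard_image_of_injective _ Subtype.val_injective]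
  congr 1
  ext v
  simp only [mem_neighborSet, Finset.coe_filter, Finset.mem_univ, true_and, Set.mem_image,
    Set.mem_ofPred_eq]
  exact ⟨fun h => ⟨⟨v, (hp _ _ h.symm).2 b.2⟩, h.symm, rfl⟩,
    by rintro ⟨a, h, rfl⟩; exact G.adj_symm h⟩

open Classical in
theorem ncard_setOf_eq_add [Fintype {v // p v}] [Fintype {v // ¬ p v}] (q : V → Prop) :
    {v | q v}.ncard = (Finset.univ.filter fun a : {v // p v} => q a).card +
      (Finset.univ.filter fun b : {v // ¬ p v} => q b).card := by
  rw [← Finset.card_map (Function.Embedding.subtype p),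
    ← Finset.card_map (Function.Embedding.subtype fun v => ¬ p v),
    ← Finset.card_union_of_disjoint, ← Set.ncard_coe_finset]
  · congr 1
    ext v
    simp only [Finset.coe_union, Finset.coe_map, Set.mem_union, Set.mem_image, Finset.coe_filter,
      Finset.mem_univ, true_and, Set.mem_ofPred_eq, Function.Embedding.subtype_apply,
      Subtype.exists, exists_and_left, exists_prop, exists_eq_right_right]
    tauto
  · rw [Finset.disjoint_left]
    intro v hv hv'
    obtain ⟨a, -, rfl⟩ := Finset.mem_map.1 hv
    obtain ⟨b, -, hb⟩ := Finset.mem_map.1 hv'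
    exact b.2 (by rw [show (b : V) = a from hb]; exact a.2)

end Translation

/-- A minimal bipartite `k`-extendable graph has at least `(m - n + 1)/k` vertices of degree
exactly `k + 1`. -/
theorem stmt19 {V : Type*} [Fintype V] (G : SimpleGraph V) (k : ℕ) (hk : 1 ≤ k)
    (hbip : G.Colorable 2) (hext : KExtendable G k)
    (hmin : ∀ e ∈ G.edgeSet, ¬ KExtendable (G.deleteEdges {e}) k) :
    k * {v | degN G v = k + 1}.ncard + Fintype.card V ≥ G.edgeSet.ncard + 1 := by
  classical
  obtain ⟨c⟩ := hbip
  obtain ⟨p, hp⟩ : ∃ p : V → Prop, ∀ u v, G.Adj u v → (p u ↔ ¬ p v) := by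
    refine ⟨fun v => c v = 0, fun u v huv => ?_⟩
    have := c.valid huv
    omega
  obtain ⟨F, hF, hFk⟩ := hext.2.2.1
  obtain ⟨M, hM, -⟩ := hext.2.2.2 F hF hFk
  obtain ⟨σ, hσ, -⟩ := exists_isPerfectPairing hp hM
  have hcard : Fintype.card {v // p v} = Fintype.card {v // ¬ p v} := Fintype.card_congr σ
  have hV : Fintype.card {v // p v} + Fintype.card {v // ¬ p v} = Fintype.card V := by
    rw [← Fintype.card_sum]
    exact Fintype.card_congr (Equiv.sumCompl p)
  have hV2 := hext.2.1
  have hs : HasSurplus (crossAdj G p) k := (hext.pairingsExtend hp).hasSurplus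
    (relConnected_of_connected hp hext.1) (by omega) hσ
  have hcrit : ∀ a b, crossAdj G p a b → ∃ X Y, IsCritical (crossAdj G p) k a b X Y := by
    intro a b hab
    refine hs.exists_isCritical (by omega) fun hs' => hmin s((a : V), (b : V)) hab ?_
    have heq : (fun x y => crossAdj G p x y ∧ ¬ (x = a ∧ y = b)) =
        crossAdj (G.deleteEdges {s((a : V), (b : V))}) p := by
      funext x y
      have hxy : s((x : V), (y : V)) = s((a : V), (b : V)) ↔ x = a ∧ y = b := by
        rw [Sym2.eq_iff]
        constructor
        · rintro (⟨h1, h2⟩ | ⟨h1, -⟩)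
          · exact ⟨Subtype.ext h1, Subtype.ext h2⟩
          · exact absurd (h1 ▸ x.2) b.2
        · rintro ⟨rfl, rfl⟩
          exact Or.inl ⟨rfl, rfl⟩
      simp only [crossAdj, deleteEdges_adj, Set.mem_singleton_iff, hxy]
    rw [heq] at hs'
    have hE := hs'.pairingsExtend hcard
    obtain ⟨τ, hτ, -⟩ := (hs'.mono (Nat.zero_le k)).pairingsExtend hcard ∅ σ (by simp) (by simp)
      Finset.card_empty
    exact KExtendable.of_pairingsExtend (fun u v huv => hp u v (deleteEdges_adj.1 huv).1)
      (by omega) hV2 (hs'.relConnected hk hcard) hE hτ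
  have hmain := hs.card_pairs_lt hcard hk (by omega) hcrit
  rw [ncard_edgeSet_eq hp, ncard_setOf_eq_add (p := p), ← hV]
  simp only [degN_left hp, degN_right hp]
  exact hmain
end
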